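/- arXiv:1207.5039 — 7 statements merged into one kernel-verified Lean document; each statement's English description precedes it below -/
import Mathlib

section
/- Let S be a real Banach space, P ⊆ S a cone, and C > 0. Let K : closure(P_C) → closure(P_C) be completely continuous (continuous and mapping bounded sets into relatively compact sets), and let θ be a nonnegative continuous concave functional on P with θ(y) ≤ ‖y‖ for all y ∈ closure(P_C). Suppose there exist constants 0 < A < B < B† ≤ C such that: (i) the set {y ∈ P(θ,B,B†) : θ(y) > B} is nonempty, and θ(Ky) > B for all y ∈ P(θ,B,B†); (ii) ‖Ky‖ < A for all y ∈ closure(P_C) with ‖y‖ ≤ A; (iii) θ(Ky) > B for all y ∈ P(θ,B,C) with ‖Ky‖ > B†. Then K has at least three fixed points y₁, y₂, y₃ in closure(P_C) satisfying ‖y₁‖ < A, θ(y₂) > B, and A < ‖y₃‖ with θ(y₃) < B. -/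
open Set

section Scarf
open Finset
variable {X I : Type} [Fintype X] [Fintype I] [DecidableEq X] [DecidableEq I]

def Dom (r : I → X ⊕ I → ℕ) (T : Finset (X ⊕ I)) : Prop :=
  ∀ y, ∃ i, ∀ t ∈ T, r i y ≤ r i t

/-- room side -/
lemma scarf_room (c : X ⊕ I → I) (i0 : I) (T : Finset (X ⊕ I))
    (hT : T.card = Fintype.card I) (hcol : T.image c ≠ Finset.univ) :
    Even ((Finset.univ.filter fun D : Finset (X ⊕ I) =>
      (D.card + 1 = Fintype.card I ∧ D.image c = Finset.univ.erase i0) ∧ D ⊆ T).card) := by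
  classical
  rcases (Finset.univ.filter fun D : Finset (X ⊕ I) =>
      (D.card + 1 = Fintype.card I ∧ D.image c = Finset.univ.erase i0) ∧ D ⊆ T).eq_empty_or_nonempty
    with h | ⟨D, hD⟩
  · rw [h]; simp
  simp only [Finset.mem_filter, Finset.mem_univ, true_and] at hD
  obtain ⟨⟨hDc, hDi⟩, hDT⟩ := hD
  obtain ⟨x, hxD, rfl⟩ : ∃ x, x ∉ D ∧ insert x D = T := by
    have h1 : (T \ D).card = 1 := by rw [Finset.card_sdiff_of_subset hDT]; omega
    obtain ⟨x, hx⟩ := Finset.card_eq_one.1 h1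
    refine ⟨x, ?_, ?_⟩
    · have : x ∈ T \ D := by rw [hx]; simp
      exact (Finset.mem_sdiff.1 this).2
    · rw [Finset.insert_eq, ← hx, Finset.sdiff_union_of_subset hDT]
  have hcx : c x ≠ i0 := by
    intro h; apply hcol
    rw [Finset.image_insert, hDi, h, Finset.insert_erase (Finset.mem_univ _)]
  have hinj : ∀ D' : Finset (X ⊕ I), D'.card + 1 = Fintype.card I →
      D'.image c = Finset.univ.erase i0 → Set.InjOn c D' := by
    intro D' h1 h2
    apply Finset.injOn_of_card_image_eq
    rw [h2, Finset.card_erase_of_mem (Finset.mem_univ _), Finset.card_univ]; omega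
  obtain ⟨x', hx'D, hx'c⟩ : ∃ x' ∈ D, c x' = c x := by
    have : c x ∈ D.image c := by rw [hDi]; simp [hcx]
    simpa using this
  have hne : x' ≠ x := fun h => hxD (h ▸ hx'D)
  have key : (Finset.univ.filter fun D' : Finset (X ⊕ I) =>
      (D'.card + 1 = Fintype.card I ∧ D'.image c = Finset.univ.erase i0) ∧ D' ⊆ insert x D)
      = {D, insert x (D.erase x')} := by
    ext D'
    simp only [Finset.mem_filter, Finset.mem_univ, true_and, Finset.mem_insert,
      Finset.mem_singleton]
    constructor
    · rintro ⟨⟨h1, h2⟩, h3⟩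
      have hi := hinj D' h1 h2
      by_cases hx : x ∈ D'
      · right
        have hx' : x' ∉ D' := fun h => hne (hi h hx hx'c)
        apply Finset.eq_of_subset_of_card_le
        · intro y hy
          have := h3 hy
          simp only [Finset.mem_insert, Finset.mem_erase] at this ⊢
          rcases this with h | h
          · exact Or.inl h
          · exact Or.inr ⟨fun e => hx' (e ▸ hy), h⟩
        · rw [Finset.card_insert_of_notMem (by simp [hxD]), Finset.card_erase_of_mem hx'D]
          have := Finset.card_pos.2 ⟨x', hx'D⟩
          omega
      · left
        apply Finset.eq_of_subset_of_card_le
        · intro y hy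
          have := h3 hy
          simp only [Finset.mem_insert] at this
          rcases this with h | h
          · exact absurd (h ▸ hy) hx
          · exact h
        · omega
    · rintro (rfl | rfl)
      · exact ⟨⟨hDc, hDi⟩, Finset.subset_insert _ _⟩
      · refine ⟨⟨?_, ?_⟩, ?_⟩
        · rw [Finset.card_insert_of_notMem (by simp [hxD]), Finset.card_erase_of_mem hx'D]
          have := Finset.card_pos.2 ⟨x', hx'D⟩
          omega
        · rw [← hDi, Finset.image_insert, ← hx'c, ← Finset.image_insert, Finset.insert_erase hx'D]
        · exact Finset.insert_subset_insert _ (Finset.erase_subset _ _)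
  rw [key, Finset.card_pair]
  · exact ⟨1, rfl⟩
  · intro h; apply hxD; rw [h]; simp

lemma rooms_eq (r : I → X ⊕ I → ℕ) (D : Finset (X ⊕ I)) (hDc : D.card + 1 = Fintype.card I) :
    ∀ T : Finset (X ⊕ I), ((T.card = Fintype.card I ∧ Dom r T) ∧ D ⊆ T) ↔
      ∃ x, x ∉ D ∧ Dom r (insert x D) ∧ T = insert x D := by
  intro T
  constructor
  · rintro ⟨⟨h1, h2⟩, h3⟩
    have h1 : (T \ D).card = 1 := by rw [Finset.card_sdiff_of_subset h3]; omega
    obtain ⟨x, hx⟩ := Finset.card_eq_one.1 h1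
    have e : insert x D = T := by
      rw [Finset.insert_eq, ← hx, Finset.sdiff_union_of_subset h3]
    refine ⟨x, ?_, e ▸ h2, e.symm⟩
    have : x ∈ T \ D := by rw [hx]; simp
    exact (Finset.mem_sdiff.1 this).2
  · rintro ⟨x, h1, h2, rfl⟩
    exact ⟨⟨by rw [Finset.card_insert_of_notMem h1, hDc], h2⟩, Finset.subset_insert _ _⟩

open Classical in
/-- outer door -/
lemma scarf_outer [Nonempty X] (r : I → X ⊕ I → ℕ) (hr : ∀ i, Function.Injective (r i))
    (h0 : ∀ i x, r i (.inr i) < r i (.inl x))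
    (h1 : ∀ i j x, j ≠ i → r i (.inl x) < r i (.inr j)) (i0 : I) :
    (Finset.univ.filter fun T : Finset (X ⊕ I) =>
      (T.card = Fintype.card I ∧ Dom r T) ∧ (Finset.univ.erase i0).image Sum.inr ⊆ T).card = 1 := by
  set D : Finset (X ⊕ I) := (Finset.univ.erase i0).image Sum.inr with hD
  have hDc : D.card + 1 = Fintype.card I := by
    rw [hD, Finset.card_image_of_injective _ Sum.inr_injective,
      Finset.card_erase_of_mem (Finset.mem_univ _), Finset.card_univ]
    have := Fintype.card_pos_iff.2 ⟨i0⟩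
    omega
  obtain ⟨xm, hxm⟩ := Finite.exists_max (fun x : X => r i0 (.inl x))
  have memD : ∀ j, j ≠ i0 → (Sum.inr j : X ⊕ I) ∈ D := by intro j hj; simp [hD, hj]
  rw [Finset.card_eq_one]
  refine ⟨insert (.inl xm) D, ?_⟩
  ext T
  simp only [Finset.mem_filter, Finset.mem_univ, true_and, Finset.mem_singleton]
  rw [rooms_eq r D hDc T]
  constructor
  · rintro ⟨x, hx, hdom, rfl⟩
    -- the room must be bounded by x
    have hy : ∀ y : X, r i0 (.inl y) ≤ r i0 x := by
      intro y
      obtain ⟨i, hi⟩ := hdom (.inl y)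
      have : i = i0 := by
        by_contra hne
        have := hi _ (Finset.mem_insert_of_mem (memD i hne))
        have := h0 i y
        omega
      subst this
      exact hi _ (Finset.mem_insert_self _ _)
    rcases x with x | j
    · have : xm = x := by
        have h2 := hxm x
        have h3 := hy xm
        exact Sum.inl_injective (hr i0 (le_antisymm h3 h2))
      rw [this]
    · exfalso
      by_cases hj : j = i0
      · subst hj
        have := hy xm
        have := h0 j xm
        omega
      · exact hx (memD j hj)
  · rintro rfl
    refine ⟨.inl xm, by simp [hD], ?_, rfl⟩
    have hmin : ∀ i y, r i (.inr i) ≤ r i y := by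
      intro i y
      rcases y with y | j
      · exact (h0 i y).le
      · by_cases hj : j = i
        · rw [hj]
        · exact ((h0 i xm).trans (h1 i j xm hj)).le
    intro y
    rcases y with y | j
    · refine ⟨i0, ?_⟩
      intro t ht
      simp only [Finset.mem_insert, hD, Finset.mem_image, Finset.mem_erase, Finset.mem_univ,
        and_true] at ht
      rcases ht with rfl | ⟨k, hk, rfl⟩
      · exact hxm y
      · exact (h1 i0 k y hk).le
    · exact ⟨j, fun t _ => hmin j t⟩

open Classical in
/-- inner door -/
lemma scarf_inner [Nonempty X] (r : I → X ⊕ I → ℕ) (hr : ∀ i, Function.Injective (r i))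
    (h0 : ∀ i x, r i (.inr i) < r i (.inl x))
    (h1 : ∀ i j x, j ≠ i → r i (.inl x) < r i (.inr j))
    (D : Finset (X ⊕ I)) (hDc : D.card + 1 = Fintype.card I)
    (xD : X) (hxD : Sum.inl xD ∈ D) :
    Even (Finset.univ.filter fun T : Finset (X ⊕ I) =>
      (T.card = Fintype.card I ∧ Dom r T) ∧ D ⊆ T).card := by
  by_cases hdom : Dom r D
  swap
  · rw [Finset.filter_eq_empty_iff.2]
    · simp
    · rintro T - ⟨⟨_, h2⟩, h3⟩
      apply hdom
      intro y
      obtain ⟨i, hi⟩ := h2 y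
      exact ⟨i, fun t ht => hi t (h3 ht)⟩
  have hm : ∀ i, ∃ d ∈ D, ∀ t ∈ D, r i d ≤ r i t := fun i =>
    Finset.exists_min_image D (r i) ⟨_, hxD⟩
  choose m hmD hmin using hm
  have hsurj : ∀ d ∈ D, ∃ i, m i = d := by
    intro d hd
    obtain ⟨i, hi⟩ := hdom d
    exact ⟨i, hr i (le_antisymm (hmin i d hd) (hi _ (hmD i)))⟩
  -- double point
  obtain ⟨a, -, b, -, hab, hmab⟩ := Finset.exists_ne_map_eq_of_card_lt_of_maps_to
    (s := (Finset.univ : Finset I)) (t := D) (f := m) (by rw [Finset.card_univ]; omega)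
    (fun i _ => hmD i)
  have hinj : ∀ e, e = a ∨ e = b → ∀ i j, i ≠ e → j ≠ e → m i = m j → i = j := by
    intro e he
    have hs : D ⊆ (Finset.univ.erase e).image m := by
      intro d hd
      obtain ⟨i, hi⟩ := hsurj d hd
      simp only [Finset.mem_image, Finset.mem_erase, Finset.mem_univ, and_true]
      by_cases hie : i = e
      · rcases he with rfl | rfl
        · exact ⟨b, hab.symm, by rw [← hmab, ← hie, hi]⟩
        · exact ⟨a, hab, by rw [hmab, ← hie, hi]⟩
      · exact ⟨i, hie, hi⟩
    have hi : Set.InjOn m (Finset.univ.erase e : Finset I) := by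
      apply Finset.injOn_of_card_image_eq
      apply le_antisymm Finset.card_image_le
      refine le_trans ?_ (Finset.card_le_card hs)
      rw [Finset.card_erase_of_mem (Finset.mem_univ _), Finset.card_univ]; omega
    intro i j h1 h2 h
    exact hi (by simp [h1]) (by simp [h2]) h
  have hmk : ∀ i k, i ≠ k → r k (m k) < r k (.inr i) := by
    intro i k hik
    exact lt_of_le_of_lt (hmin k _ hxD) (h1 k i xD hik)
  have hx : ∀ e, ∃ x, (∀ k, k ≠ e → r k (m k) < r k x) ∧
      ∀ y, (∀ k, k ≠ e → r k (m k) < r k y) → r e y ≤ r e x := by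
    intro e
    obtain ⟨x, hx, hx'⟩ := Finset.exists_max_image
      (Finset.univ.filter fun y : X ⊕ I => ∀ k, k ≠ e → r k (m k) < r k y) (r e)
      ⟨.inr e, by simpa using fun k hk => hmk e k (Ne.symm hk)⟩
    refine ⟨x, by simpa using hx, fun y hy => hx' y (by simpa using hy)⟩
  choose x hx1 hx2 using hx
  have hxnD : ∀ e, e = a ∨ e = b → x e ∉ D := by
    intro e he hxe
    obtain ⟨j, hj⟩ := hsurj _ hxe
    have : ∃ k, k ≠ e ∧ m k = x e := by
      by_cases hje : j = e
      · rcases he with rfl | rfl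
        · exact ⟨b, hab.symm, by rw [← hmab, ← hje, hj, hje]⟩
        · exact ⟨a, hab, by rw [hmab, ← hje, hj, hje]⟩
      · exact ⟨j, hje, hj⟩
    obtain ⟨k, hk, hke⟩ := this
    have := hx1 e k hk
    rw [hke] at this
    omega
  -- r e (x e) < r e (m e) from dominance
  have hxlt : ∀ e, r e (x e) ≤ r e (m e) := by
    intro e
    obtain ⟨i, hi⟩ := hdom (x e)
    by_cases hie : i = e
    · subst hie; exact hi _ (hmD i)
    · have := hx1 e i hie
      have := hi _ (hmD i)
      omega
  have hdomx : ∀ e, Dom r (insert (x e) D) := by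
    intro e y
    by_contra hcon
    push Not at hcon
    have hy : ∀ i, r i (m i) < r i y ∨ r i (x e) < r i y := by
      intro i
      obtain ⟨t, ht, hti⟩ := hcon i
      rcases Finset.mem_insert.1 ht with rfl | ht
      · right; exact hti
      · left; exact lt_of_le_of_lt (hmin i t ht) hti
    have h2 : ∀ k, k ≠ e → r k (m k) < r k y := by
      intro k hk
      rcases hy k with h | h
      · exact h
      · exact (hx1 e k hk).trans h
    have h3 := hx2 e y h2
    rcases hy e with h | h
    · have := hxlt e; omega
    · omega
  have hconv : ∀ z, z ∉ D → Dom r (insert z D) → z = x a ∨ z = x b := by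
    intro z hz hdz
    -- z is a strict minimum in some order e
    obtain ⟨e, he⟩ := hdz z
    have he' : r e z ≤ r e (m e) := he _ (Finset.mem_insert_of_mem (hmD e))
    -- other members of D are minimal in insert z D in some order ≠ e
    have hother : ∀ d ∈ D, ∃ k, k ≠ e ∧ m k = d ∧ r k d < r k z := by
      intro d hd
      obtain ⟨k, hk⟩ := hdz d
      have hkz := hk z (Finset.mem_insert_self _ _)
      have hne : r k d ≠ r k z := fun h => hz (hr k h ▸ hd)
      refine ⟨k, ?_, ?_, lt_of_le_of_ne hkz hne⟩
      · rintro rfl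
        have := he d (Finset.mem_insert_of_mem hd)
        omega
      · exact hr k (le_antisymm (hmin k d hd) (hk _ (Finset.mem_insert_of_mem (hmD k))))
    have hab' : e = a ∨ e = b := by
      by_contra hcon
      push Not at hcon
      obtain ⟨k, hk, hkm, -⟩ := hother (m e) (hmD e)
      -- k = e unless k,e both in {a,b}
      have := hinj a (Or.inl rfl) k e
      have := hinj b (Or.inr rfl) k e
      by_cases hka : k = a
      · have h3 : k ≠ b := fun h => hab (hka ▸ h)
        exact hk (this h3 hcon.2 hkm)
      · exact hk (hinj a (Or.inl rfl) k e hka hcon.1 hkm)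
    have hzk : ∀ k, k ≠ e → r k (m k) < r k z := by
      intro k hk
      obtain ⟨k', hk', hkm, hlt⟩ := hother (m k) (hmD k)
      have : k' = k := hinj e hab' k' k hk' hk hkm
      subst this; exact hlt
    have hzx : z = x e := by
      have h2 := hx2 e z hzk
      obtain ⟨i, hi⟩ := hdz (x e)
      have hie : i = e := by
        by_contra hne
        have := hx1 e i hne
        have := hi _ (Finset.mem_insert_of_mem (hmD i))
        omega
      subst hie
      exact hr i (le_antisymm h2 (hi z (Finset.mem_insert_self _ _)))
    rcases hab' with rfl | rfl
    · exact Or.inl hzx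
    · exact Or.inr hzx
  have hxab : x a ≠ x b := by
    intro h
    have h2 := hx1 b a hab
    have h3 := hxlt a
    rw [h] at h3
    omega
  have key : (Finset.univ.filter fun T : Finset (X ⊕ I) =>
      (T.card = Fintype.card I ∧ Dom r T) ∧ D ⊆ T) = {insert (x a) D, insert (x b) D} := by
    ext T
    simp only [Finset.mem_filter, Finset.mem_univ, true_and, Finset.mem_singleton,
      Finset.mem_insert]
    rw [rooms_eq r D hDc T]
    constructor
    · rintro ⟨z, hz, hd, rfl⟩
      rcases hconv z hz hd with rfl | rfl
      · exact Or.inl rfl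
      · exact Or.inr rfl
    · rintro (rfl | rfl)
      · exact ⟨x a, hxnD a (Or.inl rfl), hdomx a, rfl⟩
      · exact ⟨x b, hxnD b (Or.inr rfl), hdomx b, rfl⟩
  rw [key, Finset.card_pair]
  · exact ⟨1, rfl⟩
  · intro h
    have : x a ∈ insert (x b) D := h ▸ Finset.mem_insert_self _ _
    rcases Finset.mem_insert.1 this with h | h
    · exact hxab h
    · exact hxnD a (Or.inl rfl) h

theorem scarf [Nonempty X] [Nonempty I] (r : I → X ⊕ I → ℕ) (hr : ∀ i, Function.Injective (r i))
    (h0 : ∀ i x, r i (.inr i) < r i (.inl x))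
    (h1 : ∀ i j x, j ≠ i → r i (.inl x) < r i (.inr j))
    (c : X ⊕ I → I) (hc : ∀ i, c (.inr i) = i) :
    ∃ T : Finset (X ⊕ I), T.card = Fintype.card I ∧ Dom r T ∧ T.image c = Finset.univ := by
  classical
  by_contra hcon
  push Not at hcon
  obtain ⟨i0⟩ := ‹Nonempty I›
  set R := (Finset.univ.filter fun T : Finset (X ⊕ I) => T.card = Fintype.card I ∧ Dom r T)
  set Dr := (Finset.univ.filter fun D : Finset (X ⊕ I) =>
    D.card + 1 = Fintype.card I ∧ D.image c = Finset.univ.erase i0)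
  have hdc := Finset.sum_card_bipartiteAbove_eq_sum_card_bipartiteBelow
    (s := Dr) (t := R) (fun D T => D ⊆ T)
  have hR : Even (∑ b ∈ R, (Finset.bipartiteBelow (fun D T => D ⊆ T) Dr b).card) := by
    apply Finset.even_sum
    intro T hT
    simp only [R, Finset.mem_filter, Finset.mem_univ, true_and] at hT
    have := scarf_room c i0 T hT.1 (hcon T hT.1 hT.2)
    rw [Finset.bipartiteBelow, Finset.filter_filter]
    exact this
  set D0 : Finset (X ⊕ I) := (Finset.univ.erase i0).image Sum.inr with hD0
  have hD0mem : D0 ∈ Dr := by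
    simp only [Dr, Finset.mem_filter, Finset.mem_univ, true_and]
    constructor
    · rw [hD0, Finset.card_image_of_injective _ Sum.inr_injective,
        Finset.card_erase_of_mem (Finset.mem_univ _), Finset.card_univ]
      have := Fintype.card_pos_iff.2 ⟨i0⟩
      omega
    · rw [hD0, Finset.image_image]
      have : c ∘ Sum.inr = id := by funext i; exact hc i
      rw [this, Finset.image_id]
  rw [← Finset.add_sum_erase _ _ hD0mem] at hdc
  have hE : Even (∑ D ∈ Dr.erase D0, (Finset.bipartiteAbove (fun D T => D ⊆ T) R D).card) := by
    apply Finset.even_sum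
    intro D hD
    rw [Finset.mem_erase] at hD
    obtain ⟨hne, hD⟩ := hD
    simp only [Dr, Finset.mem_filter, Finset.mem_univ, true_and] at hD
    have : ∃ x, Sum.inl x ∈ D := by
      by_contra hno
      push Not at hno
      apply hne
      apply Finset.eq_of_subset_of_card_le
      · intro y hy
        rcases y with y | j
        · exact absurd hy (hno y)
        · have : c (.inr j) ∈ D.image c := Finset.mem_image_of_mem _ hy
          rw [hD.2, hc] at this
          simpa [hD0] using this
      · simp only [Dr, Finset.mem_filter, Finset.mem_univ, true_and] at hD0mem
        omega
    obtain ⟨xD, hxD⟩ := this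
    have := scarf_inner r hr h0 h1 D hD.1 xD hxD
    rw [Finset.bipartiteAbove, Finset.filter_filter]
    exact this
  have hO : (Finset.bipartiteAbove (fun D T => D ⊆ T) R D0).card = 1 := by
    have := scarf_outer r hr h0 h1 i0
    rw [Finset.bipartiteAbove, Finset.filter_filter]
    exact this
  rw [hO] at hdc
  rw [← hdc] at hR
  have := hE.one_add
  exact (Nat.not_even_iff_odd.2 this) hR
end Scarf

lemma grid_approx {I : Type} [Fintype I] [DecidableEq I] [Nonempty I] (f : (I → ℝ) → (I → ℝ))
    (hf : ∀ x ∈ stdSimplex ℝ I, f x ∈ stdSimplex ℝ I) (m : ℕ) (hm : 0 < m) :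
    ∃ u ∈ stdSimplex ℝ I, ∀ i, u i ≤ (Fintype.card I : ℝ) / m ∨
      ∃ v ∈ stdSimplex ℝ I, (∀ j, |u j - v j| ≤ (Fintype.card I : ℝ) / m) ∧ v i ≤ f v i := by
  classical
  let X := {x : I → Fin (m+1) // ∑ i, (x i : ℕ) = m}
  have mkX : ∀ y : I → ℕ, ∑ i, y i = m → ∃ x : X, ∀ i, (x.1 i : ℕ) = y i := by
    intro y hy
    have hle : ∀ i, y i < m + 1 := by
      intro i
      have := Finset.single_le_sum (f := y) (fun j _ => Nat.zero_le _) (Finset.mem_univ i)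
      omega
    exact ⟨⟨fun i => ⟨y i, hle i⟩, hy⟩, fun i => rfl⟩
  have i0 : I := Classical.arbitrary I
  have : Nonempty X := by
    obtain ⟨x, -⟩ := mkX (fun i => if i = i0 then m else 0) (by simp)
    exact ⟨x⟩
  let pt : X → I → ℝ := fun x i => ((x.1 i : ℕ) : ℝ) / m
  have hm' : (0:ℝ) < m := by exact_mod_cast hm
  have hpt : ∀ x, pt x ∈ stdSimplex ℝ I := by
    intro x
    refine ⟨fun i => by positivity, ?_⟩
    simp only [pt]
    rw [← Finset.sum_div, div_eq_one_iff_eq hm'.ne']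
    exact_mod_cast x.2
  have hcol : ∀ x, ∃ i, pt x i ≤ f (pt x) i := by
    intro x
    by_contra hcon
    push Not at hcon
    have h1 := (hpt x).2
    have h2 := (hf _ (hpt x)).2
    have := Finset.sum_lt_sum_of_nonempty (s := (Finset.univ : Finset I)) Finset.univ_nonempty
      (fun i _ => hcon i)
    linarith
  choose c0 hc0 using hcol
  let e := Fintype.equivFin (X ⊕ I)
  set N := Fintype.card (X ⊕ I) with hN
  let q : I → X ⊕ I → ℕ := fun i => Sum.elim (fun x => 1 + (x.1 i : ℕ))
    (fun j => if j = i then 0 else m + 2)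
  let r : I → X ⊕ I → ℕ := fun i y => q i y * N + (e y : ℕ)
  have hlt : ∀ i y z, q i y < q i z → r i y < r i z := by
    intro i y z h
    have h1 : (e y : ℕ) < N := (e y).2
    have h2 : (q i y + 1) * N ≤ q i z * N := Nat.mul_le_mul_right _ h
    simp only [r]
    have h3 : (q i y + 1) * N = q i y * N + N := by ring
    omega
  have hr : ∀ i, Function.Injective (r i) := by
    intro i y z h
    rcases lt_trichotomy (q i y) (q i z) with h1 | h1 | h1
    · exact absurd h (hlt i y z h1).ne
    · simp only [r, h1] at h
      exact e.injective (Fin.ext (by omega))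
    · exact absurd h (hlt i z y h1).ne'
  obtain ⟨T, hTc, hdom, himg⟩ := scarf r hr
    (fun i x => hlt _ _ _ (by simp only [q, Sum.elim_inl, Sum.elim_inr, if_true]; omega))
    (fun i j x hj => hlt _ _ _ (by
      simp only [q, Sum.elim_inl, Sum.elim_inr, if_neg hj]
      have := (x.1 i).2
      omega))
    (Sum.elim c0 id) (fun i => rfl)
  have hcolT : ∀ i, Sum.inr i ∉ T → ∃ a, Sum.inl a ∈ T ∧ c0 a = i := by
    intro i hi
    have : i ∈ T.image (Sum.elim c0 id) := by rw [himg]; simp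
    obtain ⟨t, ht, hti⟩ := Finset.mem_image.1 this
    rcases t with a | j
    · exact ⟨a, ht, hti⟩
    · simp only [Sum.elim_inr, id] at hti
      exact absurd (hti ▸ ht) hi
  have hdom' : ∀ y : X, ∃ i, Sum.inr i ∉ T ∧ ∀ a, Sum.inl a ∈ T → (y.1 i : ℕ) ≤ a.1 i := by
    intro y
    obtain ⟨i, hi⟩ := hdom (.inl y)
    refine ⟨i, fun h => ?_, fun a ha => ?_⟩
    · have h1 := hi _ h
      have := hlt i (.inr i) (.inl y) (by simp only [q, Sum.elim_inl, Sum.elim_inr, if_true]; omega)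
      omega
    · by_contra hcon
      push Not at hcon
      have h1 := hi _ ha
      have := hlt i (.inl a) (.inl y) (by simp only [q, Sum.elim_inl]; omega)
      omega
  obtain ⟨iC, hiC, -⟩ := hdom' (Classical.arbitrary X)
  obtain ⟨a0, ha0, -⟩ := hcolT iC hiC
  have hb : ∀ j, ∃ b : X, Sum.inl b ∈ T ∧ ∀ a : X, Sum.inl a ∈ T → (b.1 j : ℕ) ≤ a.1 j := by
    intro j
    obtain ⟨b, hb, hb'⟩ := Finset.exists_min_image
      (Finset.univ.filter fun a : X => Sum.inl a ∈ T) (fun a => (a.1 j : ℕ)) ⟨a0, by simpa using ha0⟩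
    exact ⟨b, by simpa using hb, fun a ha => hb' a (by simpa using ha)⟩
  choose b hbT hbmin using hb
  let μ : I → ℕ := fun j => if Sum.inr j ∈ T then 0 else (b j).1 j
  let ν : I → ℕ := fun j => if Sum.inr j ∈ T then 0 else (b j).1 j + 1
  have hν : m < ∑ j, ν j := by
    by_contra hcon
    push Not at hcon
    obtain ⟨y, hy⟩ := mkX (fun j => ν j + if j = iC then m - ∑ j, ν j else 0) (by
      rw [Finset.sum_add_distrib]; simp; omega)
    obtain ⟨i, hi, hi'⟩ := hdom' y
    have h1 := hi' (b i) (hbT i)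
    have h2 := hy i
    simp only [ν, if_neg hi] at h2
    omega
  have hμν : ∑ j, ν j ≤ ∑ j, μ j + Fintype.card I := by
    calc ∑ j, ν j ≤ ∑ j, (μ j + 1) := by
          apply Finset.sum_le_sum
          intro j _
          simp only [μ, ν]; split_ifs <;> omega
      _ = _ := by rw [Finset.sum_add_distrib]; simp
  have hμle : ∀ a : X, Sum.inl a ∈ T → ∀ j, μ j ≤ a.1 j := by
    intro a ha j
    simp only [μ]; split_ifs
    · omega
    · exact hbmin j a ha
  have hub : ∀ a : X, Sum.inl a ∈ T → ∀ j, (a.1 j : ℕ) ≤ μ j + Fintype.card I := by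
    intro a ha j
    have h1 : ∑ k, (a.1 k : ℕ) = ∑ k, μ k + ∑ k, ((a.1 k : ℕ) - μ k) := by
      rw [← Finset.sum_add_distrib]
      apply Finset.sum_congr rfl
      intro k _
      have := hμle a ha k
      omega
    have h2 := Finset.single_le_sum (f := fun k => (a.1 k : ℕ) - μ k) (fun j _ => Nat.zero_le _)
      (Finset.mem_univ j)
    have h3 := a.2
    omega
  refine ⟨pt a0, hpt a0, fun i => ?_⟩
  by_cases hi : Sum.inr i ∈ T
  · left
    have := hub a0 ha0 i
    simp only [μ, if_pos hi, zero_add] at this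
    simp only [pt]
    gcongr
  · right
    obtain ⟨a, ha, hai⟩ := hcolT i hi
    refine ⟨pt a, hpt a, fun j => ?_, hai ▸ hc0 a⟩
    simp only [pt]
    rw [← sub_div, abs_div, abs_of_pos hm']
    gcongr
    have h1 := hub a0 ha0 j
    have h2 := hμle a0 ha0 j
    have h3 := hub a ha j
    have h4 := hμle a ha j
    have h5 : ((a0.1 j : ℕ) : ℝ) ≤ (a.1 j : ℕ) + Fintype.card I := by
      exact_mod_cast (by omega : (a0.1 j : ℕ) ≤ (a.1 j : ℕ) + Fintype.card I)
    have h6 : ((a.1 j : ℕ) : ℝ) ≤ (a0.1 j : ℕ) + Fintype.card I := by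
      exact_mod_cast (by omega : (a.1 j : ℕ) ≤ (a0.1 j : ℕ) + Fintype.card I)
    rw [abs_le]; constructor <;> linarith

theorem brouwer_simplex {I : Type} [Fintype I] [Nonempty I] (f : (I → ℝ) → (I → ℝ))
    (hf : ∀ x ∈ stdSimplex ℝ I, f x ∈ stdSimplex ℝ I) (hc : ContinuousOn f (stdSimplex ℝ I)) :
    ∃ x ∈ stdSimplex ℝ I, f x = x := by
  classical
  have hK : IsCompact (stdSimplex ℝ I) := isCompact_stdSimplex ℝ I
  have hu := hK.uniformContinuousOn_of_continuous hc
  rw [Metric.uniformContinuousOn_iff] at hu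
  -- approximate solutions
  have happ : ∀ n : ℕ, ∃ u ∈ stdSimplex ℝ I, ∀ i, u i ≤ f u i + 1 / ((n:ℝ) + 1) := by
    intro n
    have hε : (0:ℝ) < 1 / ((n:ℝ) + 1) := by positivity
    set ε := 1 / ((n:ℝ) + 1)
    obtain ⟨δ, hδ, H⟩ := hu (ε/2) (by positivity)
    obtain ⟨m, hm⟩ := exists_nat_gt ((Fintype.card I : ℝ) / (min (δ/2) (ε/2)))
    have hmin : 0 < min (δ/2) (ε/2) := by positivity
    have hm0 : (0:ℝ) < m := lt_of_le_of_lt (by positivity) hm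
    have hle : (Fintype.card I : ℝ) / m ≤ min (δ/2) (ε/2) := by
      rw [div_le_iff₀ hm0]
      rw [div_lt_iff₀ hmin] at hm
      linarith
    obtain ⟨u, hu, hu'⟩ := grid_approx f hf m (by exact_mod_cast hm0)
    refine ⟨u, hu, fun i => ?_⟩
    have hle1 := hle.trans (min_le_left _ _)
    have hle2 := hle.trans (min_le_right _ _)
    rcases hu' i with h | ⟨v, hv, hd, hvi⟩
    · have := (hf u hu).1 i
      linarith
    · have h1 : dist u v < δ := by
        refine lt_of_le_of_lt ((dist_pi_le_iff (by positivity : (0:ℝ) ≤ δ/2)).2 fun j => ?_)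
          (by linarith : δ/2 < δ)
        rw [Real.dist_eq]; exact (hd j).trans hle1
      have h2 := (dist_le_pi_dist (f u) (f v) i).trans_lt (H u hu v hv h1)
      rw [Real.dist_eq] at h2
      have h3 := (hd i).trans hle2
      have h4 := (abs_lt.1 h2).1
      have h5 := (abs_le.1 h3).2
      linarith
  choose u hu1 hu2 using happ
  obtain ⟨x, hx, φ, hφ, hlim⟩ := hK.tendsto_subseq hu1
  have hflim : Filter.Tendsto (fun n => f (u (φ n))) Filter.atTop (nhds (f x)) :=
    (hc x hx).tendsto.comp (tendsto_nhdsWithin_iff.2 ⟨hlim, Filter.Eventually.of_forall fun n => hu1 _⟩)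
  have hle : ∀ i, x i ≤ f x i := by
    intro i
    have h1 := (tendsto_pi_nhds.1 hlim i)
    have h2 := (tendsto_pi_nhds.1 hflim i)
    have h3 := (tendsto_one_div_add_atTop_nhds_zero_nat (𝕜 := ℝ)).comp hφ.tendsto_atTop
    have h4 := h2.add h3
    rw [add_zero] at h4
    exact le_of_tendsto_of_tendsto' h1 h4 (fun n => hu2 (φ n) i)
  refine ⟨x, hx, ?_⟩
  have := (Finset.sum_eq_sum_iff_of_le (fun i (_ : i ∈ Finset.univ) => hle i)).1
    (hx.2.trans (hf x hx).2.symm)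
  funext i
  exact (this i (Finset.mem_univ i)).symm

theorem schauder {V : Type*} [NormedAddCommGroup V] [NormedSpace ℝ V] (E Kc : Set V)
    (hne : E.Nonempty) (hconv : Convex ℝ E) (F : V → V) (hF : ContinuousOn F E)
    (hKc : IsCompact Kc) (hKE : Kc ⊆ E) (hFK : ∀ x ∈ E, F x ∈ Kc) :
    ∃ x ∈ E, F x = x := by
  classical
  have happ : ∀ n : ℕ, ∃ x ∈ E, ‖x - F x‖ ≤ 1 / ((n:ℝ) + 1) := by
    intro n
    have hε : (0:ℝ) < 1 / ((n:ℝ) + 1) := by positivity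
    set ε := 1 / ((n:ℝ) + 1)
    obtain ⟨t, htK, htf, htc⟩ := hKc.finite_cover_balls hε
    obtain ⟨N, p, hp⟩ : ∃ (N : ℕ) (p : Fin N → V), Set.range p = t := by
      obtain ⟨N, p, -, hp⟩ := htf.fin_param
      exact ⟨N, p, hp⟩
    have hpE : ∀ i, p i ∈ E := fun i => hKE (htK (hp ▸ Set.mem_range_self i))
    have hcov : ∀ z ∈ Kc, ∃ i, dist z (p i) < ε := by
      intro z hz
      obtain ⟨y, hy, hzy⟩ := Set.mem_iUnion₂.1 (htc hz)
      rw [← hp] at hy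
      obtain ⟨i, rfl⟩ := hy
      exact ⟨i, hzy⟩
    obtain ⟨x0, hx0⟩ := hne
    have : Nonempty (Fin N) := ⟨(hcov _ (hFK x0 hx0)).choose⟩
    let φ : Fin N → V → ℝ := fun i z => max 0 (ε - dist z (p i))
    have hφ0 : ∀ i z, 0 ≤ φ i z := fun i z => le_max_left _ _
    have hφc : ∀ i, Continuous (φ i) := by intro i; fun_prop
    have hφs : ∀ z ∈ Kc, 0 < ∑ i, φ i z := by
      intro z hz
      obtain ⟨i, hi⟩ := hcov z hz
      apply Finset.sum_pos' (fun i _ => hφ0 i z)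
      exact ⟨i, Finset.mem_univ _, lt_max_of_lt_right (by linarith)⟩
    let L : (Fin N → ℝ) → V := fun w => ∑ i, w i • p i
    have hL : Continuous L := by fun_prop
    have hLE : ∀ w ∈ stdSimplex ℝ (Fin N), L w ∈ E := fun w hw =>
      hconv.sum_mem (fun i _ => hw.1 i) hw.2 (fun i _ => hpE i)
    let g : (Fin N → ℝ) → (Fin N → ℝ) := fun w i => φ i (F (L w)) / ∑ j, φ j (F (L w))
    have hFL : ContinuousOn (fun w => F (L w)) (stdSimplex ℝ (Fin N)) :=
      hF.comp hL.continuousOn hLE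
    obtain ⟨w, hw, hgw⟩ := brouwer_simplex g (by
      intro w hw
      have hs := hφs _ (hFK _ (hLE w hw))
      refine ⟨fun i => div_nonneg (hφ0 _ _) hs.le, ?_⟩
      simp only [g]
      rw [← Finset.sum_div, div_self hs.ne']) (by
      apply continuousOn_pi.2
      intro i
      apply ContinuousOn.div
      · exact (hφc i).comp_continuousOn hFL
      · exact continuousOn_finsetSum _ fun j _ => (hφc j).comp_continuousOn hFL
      · intro w hw
        exact (hφs _ (hFK _ (hLE w hw))).ne')
    refine ⟨L w, hLE w hw, ?_⟩
    have h1 : L w - F (L w) = ∑ i, w i • (p i - F (L w)) := by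
      simp only [smul_sub, Finset.sum_sub_distrib]
      rw [← Finset.sum_smul, hw.2, one_smul]
    rw [h1]
    calc ‖∑ i, w i • (p i - F (L w))‖ ≤ ∑ i, ‖w i • (p i - F (L w))‖ := norm_sum_le _ _
      _ ≤ ∑ i, w i * ε := by
        apply Finset.sum_le_sum
        intro i _
        rw [norm_smul, Real.norm_eq_abs, abs_of_nonneg (hw.1 i)]
        by_cases hi : dist (F (L w)) (p i) < ε
        · apply mul_le_mul_of_nonneg_left _ (hw.1 i)
          rw [← dist_eq_norm, dist_comm]; exact hi.le
        · have : w i = 0 := by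
            rw [← hgw]
            simp only [g, φ]
            rw [max_eq_left (by linarith), zero_div]
          rw [this]; simp
      _ = ε := by rw [← Finset.sum_mul, hw.2, one_mul]
  choose x hxE hx using happ
  obtain ⟨z, hz, φ, hφ, hlim⟩ := hKc.tendsto_subseq (fun n => hFK _ (hxE n))
  have h3 := (tendsto_one_div_add_atTop_nhds_zero_nat (𝕜 := ℝ)).comp hφ.tendsto_atTop
  have h4 : Filter.Tendsto (fun n => x (φ n) - F (x (φ n))) Filter.atTop (nhds 0) :=
    squeeze_zero_norm (fun n => hx (φ n)) h3
  have h5 : Filter.Tendsto (fun n => x (φ n)) Filter.atTop (nhds z) := by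
    have := h4.add hlim
    simpa using this
  have h6 : Filter.Tendsto (fun n => F (x (φ n))) Filter.atTop (nhds (F z)) :=
    (hF z (hKE hz)).tendsto.comp
      (tendsto_nhdsWithin_iff.2 ⟨h5, Filter.Eventually.of_forall fun n => hxE _⟩)
  exact ⟨z, hKE hz, tendsto_nhds_unique h6 hlim⟩

lemma contOn_max {Z : Type*} [TopologicalSpace Z] {f g : Z → ℝ} {s : Set Z}
    (hf : ContinuousOn f s) (hg : ContinuousOn g s) :
    ContinuousOn (fun x => max (f x) (g x)) s :=
  continuous_max.comp_continuousOn (hf.prodMk hg)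

lemma contOn_min {Z : Type*} [TopologicalSpace Z] {f g : Z → ℝ} {s : Set Z}
    (hf : ContinuousOn f s) (hg : ContinuousOn g s) :
    ContinuousOn (fun x => min (f x) (g x)) s :=
  continuous_min.comp_continuousOn (hf.prodMk hg)

lemma closure_PC {S : Type*} [NormedAddCommGroup S] [NormedSpace ℝ S] (P : Set S)
    (hPclosed : IsClosed P) (hPsmul : ∀ ζ : ℝ, 0 ≤ ζ → ∀ y ∈ P, ζ • y ∈ P) (C : ℝ) (hC : 0 < C) :
    closure {y ∈ P | ‖y‖ < C} = {y ∈ P | ‖y‖ ≤ C} := by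
  apply subset_antisymm
  · apply closure_minimal
    · rintro y ⟨h1, h2⟩; exact ⟨h1, h2.le⟩
    · exact hPclosed.inter (isClosed_le continuous_norm continuous_const)
  · rintro y ⟨h1, h2⟩
    have hu : Filter.Tendsto (fun n : ℕ => (1 - 1 / ((n:ℝ) + 1)) • y) Filter.atTop (nhds y) := by
      have := (tendsto_const_nhds (x := (1:ℝ))).sub (tendsto_one_div_add_atTop_nhds_zero_nat (𝕜 := ℝ))
      have := this.smul_const y
      simpa using this
    refine mem_closure_of_tendsto hu (Filter.Eventually.of_forall fun n => ?_)
    have hp : (0:ℝ) < 1 / ((n:ℝ) + 1) := by positivity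
    have hp1 : 1 / ((n:ℝ) + 1) ≤ 1 := by
      rw [div_le_one (by positivity)]; linarith [(Nat.cast_nonneg n : (0:ℝ) ≤ n)]
    refine ⟨hPsmul _ (by linarith) y h1, ?_⟩
    rw [norm_smul, Real.norm_eq_abs, abs_of_nonneg (by linarith)]
    rcases eq_or_lt_of_le (norm_nonneg y) with h | h
    · rw [← h]; simpa using hC
    · nlinarith

lemma exists_rho2 {S : Type*} [NormedAddCommGroup S] [NormedSpace ℝ S]
    (P : Set S) (hPconvex : Convex ℝ P)
    (hPsmul : ∀ ζ : ℝ, 0 ≤ ζ → ∀ y ∈ P, ζ • y ∈ P)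
    (θ : S → ℝ) (hθcont : ContinuousOn θ P)
    (hθconcave : ∀ x ∈ P, ∀ y ∈ P, ∀ t : ℝ, 0 ≤ t → t ≤ 1 →
      t * θ x + (1 - t) * θ y ≤ θ (t • x + (1 - t) • y))
    (B B' : ℝ) (hB : 0 < B')
    (h1a : {y ∈ {y ∈ P | B ≤ θ y ∧ ‖y‖ ≤ B'} | B < θ y}.Nonempty) :
    ∃ ρ : S → S, ContinuousOn ρ P ∧ (∀ x ∈ P, ρ x ∈ P ∧ B ≤ θ (ρ x) ∧ ‖ρ x‖ ≤ B') ∧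
      ∀ x, B ≤ θ x → ‖x‖ ≤ B' → ρ x = x := by
  obtain ⟨z0, ⟨hz0P, -, hz0n⟩, hz0θ⟩ := h1a
  obtain ⟨z, hzP, hzθ, hzn⟩ : ∃ z ∈ P, B < θ z ∧ ‖z‖ < B' := by
    have hu : Filter.Tendsto (fun n : ℕ => (1 - 1 / ((n:ℝ) + 1)) • z0) Filter.atTop (nhds z0) := by
      have := (tendsto_const_nhds (x := (1:ℝ))).sub (tendsto_one_div_add_atTop_nhds_zero_nat (𝕜 := ℝ))
      have := this.smul_const z0
      simpa using this
    have hp1 : ∀ n : ℕ, 1 / ((n:ℝ) + 1) ≤ 1 := fun n => by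
      rw [div_le_one (by positivity)]; linarith [(Nat.cast_nonneg n : (0:ℝ) ≤ n)]
    have hmem : ∀ n : ℕ, (1 - 1 / ((n:ℝ) + 1)) • z0 ∈ P := fun n =>
      hPsmul _ (by linarith [hp1 n]) _ hz0P
    have hl := (hθcont z0 hz0P).tendsto.comp
      (tendsto_nhdsWithin_iff.2 ⟨hu, Filter.Eventually.of_forall hmem⟩)
    obtain ⟨n, hn⟩ := (hl.eventually (lt_mem_nhds hz0θ)).exists
    refine ⟨_, hmem n, hn, ?_⟩
    have hp : (0:ℝ) < 1 / ((n:ℝ) + 1) := by positivity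
    have := hp1 n
    rw [norm_smul, Real.norm_eq_abs, abs_of_nonneg (by linarith)]
    rcases eq_or_lt_of_le (norm_nonneg z0) with h | h
    · rw [← h]; simpa using hB
    · nlinarith
  let t1 : S → ℝ := fun x => max (B - θ x) 0 / (max (B - θ x) 0 + (θ z - B))
  let t2 : S → ℝ := fun x => max (‖x‖ - B') 0 / (max (‖x‖ - B') 0 + (B' - ‖z‖))
  have hfrac : ∀ g a : ℝ, 0 ≤ g → 0 < a → 0 ≤ g / (g + a) ∧ g / (g + a) ≤ 1 := by
    intro g a hg ha
    refine ⟨by positivity, ?_⟩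
    rw [div_le_one (by positivity)]; linarith
  have ha : 0 < θ z - B := by linarith
  have hb : 0 < B' - ‖z‖ := by linarith
  have ht1 : ∀ x, 0 ≤ t1 x ∧ t1 x ≤ 1 := fun x => hfrac _ _ (le_max_right _ _) ha
  have ht2 : ∀ x, 0 ≤ t2 x ∧ t2 x ≤ 1 := fun x => hfrac _ _ (le_max_right _ _) hb
  let t : S → ℝ := fun x => max (t1 x) (t2 x)
  have ht : ∀ x, 0 ≤ t x ∧ t x ≤ 1 := fun x =>
    ⟨(ht1 x).1.trans (le_max_left _ _), max_le (ht1 x).2 (ht2 x).2⟩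
  have ht1c : ContinuousOn t1 P := by
    have h : ContinuousOn (fun x => max (B - θ x) 0) P :=
      contOn_max (continuousOn_const.sub hθcont) continuousOn_const
    exact h.div (h.add continuousOn_const) fun x _ => by
      have := le_max_right (B - θ x) 0
      linarith
  have ht2c : ContinuousOn t2 P := by
    have h : ContinuousOn (fun x : S => max (‖x‖ - B') 0) P := by fun_prop
    exact h.div (h.add continuousOn_const) fun x _ => by
      have := le_max_right (‖x‖ - B') 0
      linarith
  have htc : ContinuousOn t P := contOn_max ht1c ht2c
  refine ⟨fun x => t x • z + (1 - t x) • x, ?_, ?_, ?_⟩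
  · exact (htc.smul continuousOn_const).add ((continuousOn_const.sub htc).smul continuousOn_id)
  · intro x hx
    obtain ⟨h0, h1⟩ := ht x
    refine ⟨hPconvex hzP hx h0 (by linarith) (by ring), ?_, ?_⟩
    · refine le_trans ?_ (hθconcave z hzP x hx _ h0 h1)
      by_cases hBx : B ≤ θ x
      · nlinarith
      · push Not at hBx
        have h2 : t1 x * (B - θ x + (θ z - B)) = B - θ x := by
          simp only [t1]
          rw [max_eq_left (by linarith)]
          exact div_mul_cancel₀ _ (by linarith)
        have h3 : t1 x ≤ t x := le_max_left _ _
        nlinarith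
    · have h4 : ‖t x • z + (1 - t x) • x‖ ≤ t x * ‖z‖ + (1 - t x) * ‖x‖ := by
        refine (norm_add_le _ _).trans ?_
        rw [norm_smul, norm_smul, Real.norm_eq_abs, Real.norm_eq_abs, abs_of_nonneg h0,
          abs_of_nonneg (by linarith)]
      refine h4.trans ?_
      by_cases hBx : ‖x‖ ≤ B'
      · nlinarith
      · push Not at hBx
        have h2 : t2 x * (‖x‖ - B' + (B' - ‖z‖)) = ‖x‖ - B' := by
          simp only [t2]
          rw [max_eq_left (by linarith)]
          exact div_mul_cancel₀ _ (by linarith)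
        have h3 : t2 x ≤ t x := le_max_right _ _
        nlinarith
  · intro x h1 h2
    have : t x = 0 := by
      simp only [t, t1, t2]
      rw [max_eq_right (by linarith : B - θ x ≤ 0), max_eq_right (by linarith : ‖x‖ - B' ≤ 0)]
      simp
    simp [this]

/-- Leggett–Williams fixed point theorem. -/
theorem leggett_williams
    {S : Type*} [NormedAddCommGroup S] [NormedSpace ℝ S] [CompleteSpace S]
    -- P is a cone in S
    (P : Set S) (hPne : P.Nonempty) (hPclosed : IsClosed P) (hPconvex : Convex ℝ P)
    (hPsmul : ∀ ζ : ℝ, 0 ≤ ζ → ∀ y ∈ P, ζ • y ∈ P)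
    (hPpoint : ∀ y ∈ P, -y ∈ P → y = 0)
    (C : ℝ) (hC : 0 < C)
    -- K is completely continuous from closure(P_C) into closure(P_C)
    (K : S → S)
    (hKmaps : ∀ y ∈ closure {y ∈ P | ‖y‖ < C}, K y ∈ closure {y ∈ P | ‖y‖ < C})
    (hKcont : ContinuousOn K (closure {y ∈ P | ‖y‖ < C}))
    (hKcompact : ∀ s ⊆ closure {y ∈ P | ‖y‖ < C}, Bornology.IsBounded s →
      IsCompact (closure (K '' s)))
    -- θ is a nonnegative continuous concave functional on P, with θ ≤ ‖·‖ on closure(P_C)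
    (θ : S → ℝ)
    (hθcont : ContinuousOn θ P)
    (hθ0 : ∀ y ∈ P, 0 ≤ θ y)
    (hθconcave : ∀ x ∈ P, ∀ y ∈ P, ∀ t : ℝ, 0 ≤ t → t ≤ 1 →
      t * θ x + (1 - t) * θ y ≤ θ (t • x + (1 - t) • y))
    (hθnorm : ∀ y ∈ closure {y ∈ P | ‖y‖ < C}, θ y ≤ ‖y‖)
    -- constants 0 < A < B < B† ≤ C
    (A B B' : ℝ) (hA : 0 < A) (hAB : A < B) (hBB' : B < B') (hB'C : B' ≤ C)
    -- (i)
    (h1a : {y ∈ {y ∈ P | B ≤ θ y ∧ ‖y‖ ≤ B'} | B < θ y}.Nonempty)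
    (h1b : ∀ y ∈ {y ∈ P | B ≤ θ y ∧ ‖y‖ ≤ B'}, B < θ (K y))
    -- (ii)
    (h2 : ∀ y ∈ closure {y ∈ P | ‖y‖ < C}, ‖y‖ ≤ A → ‖K y‖ < A)
    -- (iii)
    (h3 : ∀ y ∈ {y ∈ P | B ≤ θ y ∧ ‖y‖ ≤ C}, B' < ‖K y‖ → B < θ (K y)) :
    ∃ y₁ ∈ closure {y ∈ P | ‖y‖ < C}, ∃ y₂ ∈ closure {y ∈ P | ‖y‖ < C},
      ∃ y₃ ∈ closure {y ∈ P | ‖y‖ < C},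
      K y₁ = y₁ ∧ K y₂ = y₂ ∧ K y₃ = y₃ ∧
      ‖y₁‖ < A ∧ B < θ y₂ ∧ A < ‖y₃‖ ∧ θ y₃ < B := by
  rw [closure_PC P hPclosed hPsmul C hC] at *
  set D : Set S := {y ∈ P | ‖y‖ ≤ C} with hD
  have hP0 : (0:S) ∈ P := by
    obtain ⟨y, hy⟩ := hPne
    simpa using hPsmul 0 le_rfl y hy
  have hDP : D ⊆ P := fun y hy => hy.1
  have hDclosed : IsClosed D := hPclosed.inter (isClosed_le continuous_norm continuous_const)
  have hDconv : Convex ℝ D := by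
    have : D = P ∩ Metric.closedBall 0 C := by ext y; simp [hD]
    rw [this]
    exact hPconvex.inter (convex_closedBall _ _)
  have hθD : ContinuousOn θ D := hθcont.mono hDP
  set Kc := closure (K '' D) with hKcdef
  have hKc : IsCompact Kc := hKcompact D subset_rfl
    ((Metric.isBounded_closedBall (x := (0:S)) (r := C)).subset fun y hy => by simpa using hy.2)
  have hKcD : Kc ⊆ D := closure_minimal (by rintro _ ⟨y, hy, rfl⟩; exact hKmaps y hy) hDclosed
  have hKmem : ∀ y ∈ D, K y ∈ Kc := fun y hy => subset_closure ⟨y, hy, rfl⟩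
  obtain ⟨ρ, hρc, hρP, hρid⟩ := exists_rho2 P hPconvex hPsmul θ hθcont hθconcave B B'
    (by linarith) h1a
  have hρD : ∀ x ∈ P, ρ x ∈ D := fun x hx => ⟨(hρP x hx).1, (hρP x hx).2.2.trans hB'C⟩
  -- fixed points in the A-ball
  obtain ⟨ε₁, hε₁, hQ1⟩ : ∃ ε > 0, ∀ x ∈ D, K x = x → ‖x‖ ≤ A → ‖x‖ ≤ A - ε := by
    have hcl : IsClosed {x ∈ Kc | (‖x‖, K x - x) ∈ Iic A ×ˢ ({0} : Set S)} := by
      apply ContinuousOn.preimage_isClosed_of_isClosed _ isClosed_closure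
        (isClosed_Iic.prod isClosed_singleton)
      exact continuous_norm.continuousOn.prodMk ((hKcont.mono hKcD).sub continuousOn_id)
    have hco := hKc.of_isClosed_subset hcl (fun x hx => hx.1)
    rcases eq_empty_or_nonempty {x ∈ Kc | (‖x‖, K x - x) ∈ Iic A ×ˢ ({0} : Set S)} with he | hne
    · refine ⟨1, one_pos, fun x hx hfix hxA => ?_⟩
      exfalso
      have : x ∈ ({x ∈ Kc | (‖x‖, K x - x) ∈ Iic A ×ˢ ({0} : Set S)}) :=
        ⟨hfix ▸ hKmem x hx, hxA, by simp [hfix]⟩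
      rw [he] at this; exact this
    · obtain ⟨w, hw, hmax⟩ := hco.exists_isMaxOn hne continuous_norm.continuousOn
      have hwA : ‖w‖ < A := by
        have h := h2 w (hKcD hw.1) hw.2.1
        have h' : K w - w = 0 := hw.2.2
        rwa [sub_eq_zero.1 h'] at h
      refine ⟨A - ‖w‖, by linarith, fun x hx hfix hxA => ?_⟩
      have : x ∈ ({x ∈ Kc | (‖x‖, K x - x) ∈ Iic A ×ˢ ({0} : Set S)}) :=
        ⟨hfix ▸ hKmem x hx, hxA, by simp [hfix]⟩
      have := hmax this
      simp only [mem_ofPred_eq] at this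
      linarith
  have hmix : ∀ x ∈ D, ∀ τ ∈ Icc (0:ℝ) 1, (1 - τ) • x + τ • ρ x ∈ D := fun x hx τ hτ =>
    hDconv hx (hρD x hx.1) (by linarith [hτ.2]) hτ.1 (by ring)
  obtain ⟨ε₂, hε₂, hQ2⟩ : ∃ ε > 0, ∀ x ∈ D, ∀ τ ∈ Icc (0:ℝ) 1,
      K ((1 - τ) • x + τ • ρ x) = x → B ≤ θ x → B + ε ≤ θ x := by
    let Q : Set (S × ℝ) := {q ∈ Kc ×ˢ Icc (0:ℝ) 1 |
      (θ q.1, K ((1 - q.2) • q.1 + q.2 • ρ q.1) - q.1) ∈ Ici B ×ˢ ({0} : Set S)}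
    have hcl : IsClosed Q := by
      apply ContinuousOn.preimage_isClosed_of_isClosed _ (isClosed_closure.prod isClosed_Icc)
        (isClosed_Ici.prod isClosed_singleton)
      have hfst : ContinuousOn (fun q : S × ℝ => q.1) (Kc ×ˢ Icc (0:ℝ) 1) :=
        continuous_fst.continuousOn
      have hm1 : MapsTo (fun q : S × ℝ => q.1) (Kc ×ˢ Icc (0:ℝ) 1) D := fun q hq => hKcD hq.1
      refine (hθD.comp hfst hm1).prodMk (ContinuousOn.sub (hKcont.comp ?_ ?_) hfst)
      · have hs : ContinuousOn (fun q : S × ℝ => q.2) (Kc ×ˢ Icc (0:ℝ) 1) :=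
          continuous_snd.continuousOn
        exact ((continuousOn_const.sub hs).smul hfst).add
          (hs.smul (hρc.comp hfst fun q hq => hDP (hm1 hq)))
      · exact fun q hq => hmix _ (hKcD hq.1) _ hq.2
    have hco : IsCompact Q := (hKc.prod isCompact_Icc).of_isClosed_subset hcl (fun x hx => hx.1)
    have hmemQ : ∀ x ∈ D, ∀ τ ∈ Icc (0:ℝ) 1,
        K ((1 - τ) • x + τ • ρ x) = x → B ≤ θ x → (x, τ) ∈ Q := by
      intro x hx τ hτ h hB
      refine ⟨⟨?_, hτ⟩, hB, by simp [h]⟩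
      have := hKmem _ (hmix x hx τ hτ)
      rwa [h] at this
    have hpos : ∀ q ∈ Q, B < θ q.1 := by
      rintro ⟨x, τ⟩ ⟨⟨hx, hτ⟩, hB, hK⟩
      replace hB : B ≤ θ x := hB
      replace hK : K ((1 - τ) • x + τ • ρ x) = x := sub_eq_zero.1 hK
      replace hx : x ∈ D := hKcD hx
      replace hτ : τ ∈ Icc (0:ℝ) 1 := hτ
      change B < θ x
      by_cases hn : ‖x‖ ≤ B'
      · rw [hρid x hB hn, ← add_smul] at hK
        simp only [sub_add_cancel, one_smul] at hK
        have := h1b x ⟨hx.1, hB, hn⟩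
        rwa [hK] at this
      · push Not at hn
        have hy := hmix x hx τ hτ
        have hθy : B ≤ θ ((1 - τ) • x + τ • ρ x) := by
          have := hθconcave (ρ x) (hρP x hx.1).1 x hx.1 τ hτ.1 hτ.2
          rw [add_comm]
          refine le_trans ?_ this
          have := (hρP x hx.1).2.1
          nlinarith [hτ.1, hτ.2]
        have := h3 _ ⟨hy.1, hθy, hy.2⟩ (by rw [hK]; exact hn)
        rwa [hK] at this
    rcases Q.eq_empty_or_nonempty with he | hne
    · refine ⟨1, one_pos, fun x hx τ hτ h hB => ?_⟩
      have := hmemQ x hx τ hτ h hB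
      rw [he] at this; exact this.elim
    · obtain ⟨w, hw, hmin⟩ := hco.exists_isMinOn hne
        (f := fun q : S × ℝ => θ q.1) (hθD.comp continuous_fst.continuousOn
          (fun q hq => hKcD hq.1.1))
      refine ⟨θ w.1 - B, by linarith [hpos w hw], fun x hx τ hτ h hB => ?_⟩
      have := hmin (hmemQ x hx τ hτ h hB)
      simp only [mem_ofPred_eq] at this
      linarith
  -- first fixed point
  obtain ⟨y₁, hy₁, hK₁⟩ := schauder {y ∈ P | ‖y‖ ≤ A} (Kc ∩ {y ∈ P | ‖y‖ ≤ A})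
    ⟨0, hP0, by simpa using hA.le⟩
    (by
      have : {y ∈ P | ‖y‖ ≤ A} = P ∩ Metric.closedBall 0 A := by ext y; simp
      rw [this]
      exact hPconvex.inter (convex_closedBall _ _)) K
    (hKcont.mono fun y hy => ⟨hy.1, hy.2.trans (by linarith)⟩)
    (hKc.inter_right (hPclosed.inter (isClosed_le continuous_norm continuous_const)))
    inter_subset_right
    (fun y hy => by
      have hyD : y ∈ D := ⟨hy.1, hy.2.trans (by linarith)⟩
      exact ⟨hKmem y hyD, (hKmaps y hyD).1, (h2 y hyD hy.2).le⟩)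
  have hy₁D : y₁ ∈ D := ⟨hy₁.1, hy₁.2.trans (by linarith)⟩
  have hD0 : (0:S) ∈ D := ⟨hP0, by simpa using hC.le⟩
  -- second fixed point
  obtain ⟨y₂, hy₂, hK₂, hy₂θ⟩ : ∃ y ∈ D, K y = y ∧ B < θ y := by
    let τ : S → ℝ := fun x => max 0 (min 1 (1 - (θ x - B) / ε₂))
    have hτ : ∀ x, τ x ∈ Icc (0:ℝ) 1 := fun x =>
      ⟨le_max_left _ _, max_le zero_le_one (min_le_left _ _)⟩
    have hτc : ContinuousOn τ D := by
      refine contOn_max continuousOn_const (contOn_min continuousOn_const ?_)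
      exact continuousOn_const.sub ((hθD.sub continuousOn_const).div_const _)
    obtain ⟨x, hx, hfix⟩ := schauder D Kc ⟨0, hD0⟩ hDconv
      (fun x => K ((1 - τ x) • x + τ x • ρ x))
      (hKcont.comp (((continuousOn_const.sub hτc).smul continuousOn_id).add
        (hτc.smul (hρc.mono hDP))) (fun x hx => hmix x hx _ (hτ x)))
      hKc hKcD (fun x hx => hKmem _ (hmix x hx _ (hτ x)))
    have hBx : B ≤ θ x := by
      by_contra hcon
      push Not at hcon
      have hτ1 : τ x = 1 := by
        have : 0 ≤ (B - θ x) / ε₂ := div_nonneg (by linarith) hε₂.le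
        have h' : (θ x - B) / ε₂ = - ((B - θ x) / ε₂) := by ring
        simp only [τ]
        rw [min_eq_left (by linarith), max_eq_right zero_le_one]
      rw [hτ1] at hfix
      simp only [sub_self, zero_smul, one_smul, zero_add] at hfix
      have := h1b _ (hρP x hx.1)
      rw [hfix] at this
      linarith
    have hBx2 := hQ2 x hx _ (hτ x) hfix hBx
    have hτ0 : τ x = 0 := by
      have : 1 ≤ (θ x - B) / ε₂ := by rw [one_le_div hε₂]; linarith
      simp only [τ]
      rw [min_eq_right (by linarith), max_eq_left (by linarith)]
    rw [hτ0] at hfix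
    simp only [sub_zero, zero_smul, one_smul, add_zero] at hfix
    exact ⟨x, hx, hfix, by linarith⟩
  -- third fixed point
  obtain ⟨y₃, hy₃, hK₃, hy₃A, hy₃θ⟩ : ∃ y ∈ D, K y = y ∧ A < ‖y‖ ∧ θ y < B := by
    let ρ₁ : S → S := fun x => (A / max A ‖x‖) • x
    have hmaxpos : ∀ x : S, 0 < max A ‖x‖ := fun x => lt_max_of_lt_left hA
    have hρ₁c : Continuous ρ₁ := by
      refine Continuous.smul (continuous_const.div (by fun_prop) fun x => (hmaxpos x).ne') continuous_id
    have hρ₁P : ∀ x ∈ P, ρ₁ x ∈ P := fun x hx => hPsmul _ (div_nonneg hA.le (hmaxpos x).le) x hx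
    have hρ₁n : ∀ x, ‖ρ₁ x‖ ≤ A := by
      intro x
      simp only [ρ₁]
      rw [norm_smul, Real.norm_eq_abs, abs_of_nonneg (div_nonneg hA.le (hmaxpos x).le),
        div_mul_eq_mul_div, div_le_iff₀ (hmaxpos x)]
      exact mul_le_mul_of_nonneg_left (le_max_right _ _) hA.le
    have hρ₁id : ∀ x, ‖x‖ ≤ A → ρ₁ x = x := by
      intro x hx
      simp only [ρ₁]
      rw [max_eq_left hx, div_self hA.ne', one_smul]
    have hρ₁D : ∀ x ∈ D, ρ₁ x ∈ D := fun x hx => ⟨hρ₁P x hx.1, (hρ₁n x).trans (by linarith)⟩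
    let lam : S → ℝ := fun x => 1/2 - max 0 (A - ‖x‖) / ε₁ + max 0 (θ x - B) / ε₂
    have hlamc : ContinuousOn lam D := by
      refine ContinuousOn.add (Continuous.continuousOn (by fun_prop)) ?_
      exact (contOn_max continuousOn_const (hθD.sub continuousOn_const)).div_const _
    let α : ℝ → ℝ := fun s => max 0 (1 - 2 * s)
    let β : ℝ → ℝ := fun s => max 0 (2 * s - 1)
    let y : ℝ × S → S := fun q => (1 - α q.1 - β q.1) • q.2 + α q.1 • ρ₁ q.2 + β q.1 • ρ q.2
    have hyD : ∀ q ∈ Icc (0:ℝ) 1 ×ˢ D, y q ∈ D := by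
      rintro ⟨s, x⟩ ⟨⟨hs0, hs1⟩, hx⟩
      simp only at hs0 hs1 hx
      simp only [y]
      rcases le_total s (1/2) with h | h
      · have hb : β s = 0 := max_eq_left (by linarith)
        have ha : α s = 1 - 2 * s := max_eq_right (by linarith)
        rw [hb, ha, zero_smul, add_zero]
        exact hDconv hx (hρ₁D x hx) (by linarith) (by linarith) (by ring)
      · have hb : β s = 2 * s - 1 := max_eq_right (by linarith)
        have ha : α s = 0 := max_eq_left (by linarith)
        rw [hb, ha, zero_smul, add_zero]
        exact hDconv hx (hρD x hx.1) (by linarith) (by linarith) (by ring)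
    have hyc : ContinuousOn y (Icc (0:ℝ) 1 ×ˢ D) := by
      have hsnd : ContinuousOn (fun q : ℝ × S => q.2) (Icc (0:ℝ) 1 ×ˢ D) :=
        continuous_snd.continuousOn
      have ha : ContinuousOn (fun q : ℝ × S => α q.1) (Icc (0:ℝ) 1 ×ˢ D) :=
        Continuous.continuousOn (by fun_prop)
      have hb : ContinuousOn (fun q : ℝ × S => β q.1) (Icc (0:ℝ) 1 ×ˢ D) :=
        Continuous.continuousOn (by fun_prop)
      refine ((((continuousOn_const.sub ha).sub hb).smul hsnd).add
        (ha.smul (hρ₁c.comp_continuousOn hsnd))).add (hb.smul (hρc.comp hsnd ?_))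
      exact fun q hq => hDP hq.2
    have hKyc : ContinuousOn (fun q => K (y q)) (Icc (0:ℝ) 1 ×ˢ D) := hKcont.comp hyc hyD
    obtain ⟨⟨s, x⟩, ⟨hs, hx⟩, hfix⟩ := schauder (Icc (0:ℝ) 1 ×ˢ D) (Icc (0:ℝ) 1 ×ˢ Kc)
      ⟨(0, 0), ⟨le_rfl, zero_le_one⟩, hD0⟩ ((convex_Icc 0 1).prod hDconv)
      (fun q => (max 0 (min 1 (2 * q.1 - lam (K (y q)))), K (y q)))
      (by
        refine ContinuousOn.prodMk ?_ hKyc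
        refine contOn_max continuousOn_const (contOn_min continuousOn_const ?_)
        exact (Continuous.continuousOn (by fun_prop)).sub
          (hlamc.comp hKyc fun q hq => hKmaps _ (hyD q hq)))
      (isCompact_Icc.prod hKc) (prod_mono subset_rfl hKcD)
      (fun q hq => ⟨⟨le_max_left _ _, max_le zero_le_one (min_le_left _ _)⟩, hKmem _ (hyD q hq)⟩)
    have hyq := hyD (s, x) ⟨hs, hx⟩
    replace hs : s ∈ Icc (0:ℝ) 1 := hs
    replace hx : x ∈ D := hx
    obtain ⟨hfs, hfx⟩ := Prod.mk.inj hfix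
    rw [hfx] at hfs
    simp only at hfs
    have hsmall : K x = x → ‖x‖ ≤ A → lam x ≤ -(1/2) := by
      intro h h'
      have h4 := hQ1 x hx h h'
      have h5 := hθnorm x hx
      have h6 : 1 ≤ max 0 (A - ‖x‖) / ε₁ := by
        rw [one_le_div hε₁]; exact le_trans (by linarith) (le_max_right _ _)
      simp only [lam]
      rw [max_eq_left (by linarith : θ x - B ≤ 0), zero_div]
      linarith
    have hbig : ∀ τ ∈ Icc (0:ℝ) 1, K ((1 - τ) • x + τ • ρ x) = x → B ≤ θ x → 3/2 ≤ lam x := by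
      intro τ hτ h h'
      have h4 := hQ2 x hx τ hτ h h'
      have h5 := hθnorm x hx
      have h6 : 1 ≤ max 0 (θ x - B) / ε₂ := by
        rw [one_le_div hε₂]; exact le_trans (by linarith) (le_max_right _ _)
      simp only [lam]
      rw [max_eq_left (by linarith : A - ‖x‖ ≤ 0), zero_div]
      linarith
    have hcases : (s = 0 ∧ 0 ≤ lam x) ∨ (s = 1 ∧ lam x ≤ 1) ∨ s = lam x := by
      rcases le_total (2 * s - lam x) 1 with h | h
      · rw [min_eq_right h] at hfs
        rcases le_total 0 (2 * s - lam x) with h' | h'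
        · rw [max_eq_right h'] at hfs; right; right; linarith
        · rw [max_eq_left h'] at hfs; left; exact ⟨hfs.symm, by linarith⟩
      · rw [min_eq_left h, max_eq_right zero_le_one] at hfs
        right; left; exact ⟨hfs.symm, by linarith⟩
    rcases hcases with ⟨rfl, hl⟩ | ⟨rfl, hl⟩ | hsl
    · exfalso
      have hyx : y (0, x) = ρ₁ x := by simp [y, α, β]
      rw [hyx] at hfx
      have h4 : ‖x‖ < A := by
        have := h2 (ρ₁ x) (hρ₁D x hx) (hρ₁n x)
        rwa [hfx] at this
      rw [hρ₁id x h4.le] at hfx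
      linarith [hsmall hfx h4.le]
    · exfalso
      have hyx : y (1, x) = ρ x := by
        have h4 : α 1 = 0 := max_eq_left (by norm_num)
        have h5 : β 1 = 1 := by simp only [β]; rw [max_eq_right] <;> norm_num
        simp [y, h4, h5]
      rw [hyx] at hfx
      have h4 := h1b _ (hρP x hx.1)
      rw [hfx] at h4
      linarith [hbig 1 ⟨zero_le_one, le_rfl⟩ (by simpa using hfx) h4.le]
    · rcases lt_or_ge ‖x‖ A with hxA | hxA
      · exfalso
        have hθx := hθnorm x hx
        have h4 : s ≤ 1/2 := by
          rw [hsl]; simp only [lam]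
          rw [max_eq_left (by linarith : θ x - B ≤ 0), zero_div]
          have := div_nonneg (le_max_left 0 (A - ‖x‖)) hε₁.le
          linarith
        have hb : β s = 0 := max_eq_left (by linarith)
        have hyx : y (s, x) = x := by
          simp only [y, hb, hρ₁id x hxA.le]
          rw [zero_smul, add_zero, ← add_smul]; simp
        rw [hyx] at hfx
        linarith [hsmall hfx hxA.le, hs.1]
      · have hA0 : max 0 (A - ‖x‖) = 0 := max_eq_left (by linarith)
        rcases lt_or_ge B (θ x) with hxB | hxB
        · exfalso
          have h4 : 1/2 ≤ s := by
            rw [hsl]; simp only [lam]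
            rw [hA0, zero_div]
            have := div_nonneg (le_max_left 0 (θ x - B)) hε₂.le
            linarith
          have ha : α s = 0 := max_eq_left (by linarith)
          have hb : β s = 2 * s - 1 := max_eq_right (by linarith)
          have hyx : y (s, x) = (1 - β s) • x + β s • ρ x := by simp [y, ha]
          rw [hyx] at hfx
          linarith [hbig (β s) ⟨by linarith, by linarith [hs.2]⟩ hfx hxB.le, hs.2]
        · have h4 : s = 1/2 := by
            rw [hsl]; simp only [lam]
            rw [hA0, max_eq_left (by linarith : θ x - B ≤ 0)]; simp
          have ha : α s = 0 := max_eq_left (by linarith)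
          have hb : β s = 0 := max_eq_left (by linarith)
          have hyx : y (s, x) = x := by simp [y, ha, hb]
          rw [hyx] at hfx
          refine ⟨x, hx, hfx, lt_of_le_of_ne hxA ?_, lt_of_le_of_ne hxB ?_⟩
          · intro h
            have := h2 x hx h.ge
            rw [hfx] at this
            linarith
          · intro h
            have := hQ2 x hx 0 ⟨le_rfl, zero_le_one⟩ (by simpa using hfx) h.ge
            linarith
  have h1A : ‖y₁‖ < A := by
    have := h2 y₁ hy₁D hy₁.2
    rwa [hK₁] at this
  exact ⟨y₁, hy₁D, y₂, hy₂, y₃, hy₃, hK₁, hK₂, hK₃, h1A, hy₂θ, hy₃A, hy₃θ⟩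
end

section
/- Let h : [0,1] → [0,∞) be continuous and let Φ₀ ≥ 0 be a constant. A continuously differentiable function y : [0,1] → ℝ satisfies y′(t) − p(t)y(t) = h(t) for all t ∈ [0,1] together with λ y(0) = y(1) + Φ₀ if and only if y(t) = ∫_0^1 G(t,s) h(s) ds + (exp(∫_0^t p(η)dη)/(λ−E))·Φ₀ for all t ∈ [0,1]. -/
open Set

lemma aux_ftc (f : ℝ → ℝ) (hf : ContinuousOn f (Icc (0:ℝ) 1)) (t : ℝ) (ht : t ∈ Icc (0:ℝ) 1) :
    HasDerivWithinAt (fun x => ∫ s in (0:ℝ)..x, f s) (f t) (Icc (0:ℝ) 1) t := by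
  set g : ℝ → ℝ := IccExtend (zero_le_one (α := ℝ)) ((Icc (0:ℝ) 1).domRestrict f) with hg
  have hgc : Continuous g := (continuousOn_iff_continuous_domRestrict.1 hf).Icc_extend'
  have hgf : ∀ x ∈ Icc (0:ℝ) 1, g x = f x := by
    intro x hx
    rw [hg, IccExtend_of_mem _ _ hx]
    rfl
  have h1 : HasDerivWithinAt (fun x => ∫ s in (0:ℝ)..x, g s) (g t) (Icc (0:ℝ) 1) t :=
    (hgc.integral_hasStrictDerivAt 0 t).hasDerivAt.hasDerivWithinAt
  rw [hgf t ht] at h1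
  have key : ∀ x ∈ Icc (0:ℝ) 1, (∫ s in (0:ℝ)..x, f s) = ∫ s in (0:ℝ)..x, g s := by
    intro x hx
    apply intervalIntegral.integral_congr
    intro s hs
    rw [uIcc_of_le hx.1] at hs
    exact (hgf s ⟨hs.1, hs.2.trans hx.2⟩).symm
  exact h1.congr key (key t ht)

/-- A continuously differentiable `y` solves the linear problem
`y′ − p·y = h`, `λ·y(0) = y(1) + Φ₀` if and only if it is given by the Green's
function representation. -/
theorem linear_bvp_green_representation
    (p : ℝ → ℝ) (hp : ContinuousOn p (Icc (0:ℝ) 1))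
    (hp0 : ∀ t ∈ Icc (0:ℝ) 1, 0 ≤ p t)
    (E : ℝ) (hE : E = Real.exp (∫ η in (0:ℝ)..1, p η))
    (lam : ℝ) (hlam : E < lam)
    (G : ℝ → ℝ → ℝ)
    (hG : ∀ t s : ℝ, G t s =
      Real.exp (∫ η in s..t, p η) / (lam - E) * (if s < t then lam else E))
    (h : ℝ → ℝ) (hh : ContinuousOn h (Icc (0:ℝ) 1))
    (hh0 : ∀ t ∈ Icc (0:ℝ) 1, 0 ≤ h t)
    (Φ₀ : ℝ) (hΦ₀ : 0 ≤ Φ₀)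
    -- y is continuously differentiable on [0,1] with derivative y'
    (y y' : ℝ → ℝ) (hy'c : ContinuousOn y' (Icc (0:ℝ) 1))
    (hyd : ∀ t ∈ Icc (0:ℝ) 1, HasDerivWithinAt y (y' t) (Icc (0:ℝ) 1) t) :
    ((∀ t ∈ Icc (0:ℝ) 1, y' t - p t * y t = h t) ∧
      lam * y 0 = y 1 + Φ₀) ↔
    (∀ t ∈ Icc (0:ℝ) 1, y t =
      (∫ s in (0:ℝ)..1, G t s * h s) +
      Real.exp (∫ η in (0:ℝ)..t, p η) / (lam - E) * Φ₀) := by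
  have hd : lam - E ≠ 0 := by linarith [hlam]
  have hii : ∀ f : ℝ → ℝ, ContinuousOn f (Icc (0:ℝ) 1) → ∀ a ∈ Icc (0:ℝ) 1, ∀ b ∈ Icc (0:ℝ) 1,
      IntervalIntegrable f MeasureTheory.volume a b := by
    intro f hf a ha b hb
    exact (hf.mono (uIcc_subset_Icc ha hb)).intervalIntegrable
  have m0 : (0:ℝ) ∈ Icc (0:ℝ) 1 := by simp
  have m1 : (1:ℝ) ∈ Icc (0:ℝ) 1 := by simp
  obtain ⟨P, hP⟩ : ∃ P : ℝ → ℝ, P = fun x => ∫ s in (0:ℝ)..x, p s := ⟨_, rfl⟩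
  have hPd : ∀ t ∈ Icc (0:ℝ) 1, HasDerivWithinAt P (p t) (Icc (0:ℝ) 1) t := by
    rw [hP]; exact aux_ftc p hp
  have hPc : ContinuousOn P (Icc (0:ℝ) 1) := fun t ht => (hPd t ht).continuousWithinAt
  have hP0 : P 0 = 0 := by simp [hP]
  have hPt : ∀ t, (∫ s in (0:ℝ)..t, p s) = P t := by simp [hP]
  have hPst : ∀ s ∈ Icc (0:ℝ) 1, ∀ t ∈ Icc (0:ℝ) 1, (∫ η in s..t, p η) = P t - P s := by
    intro s hs t ht
    rw [← hPt, ← hPt, intervalIntegral.integral_interval_sub_left (hii p hp _ m0 _ ht)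
      (hii p hp _ m0 _ hs)]
  obtain ⟨q, hq⟩ : ∃ q : ℝ → ℝ, q = fun s => Real.exp (-P s) * h s := ⟨_, rfl⟩
  have hqc : ContinuousOn q (Icc (0:ℝ) 1) := by
    rw [hq]; exact (hPc.neg.rexp).mul hh
  obtain ⟨H, hH⟩ : ∃ H : ℝ → ℝ, H = fun x => ∫ s in (0:ℝ)..x, q s := ⟨_, rfl⟩
  have hHd : ∀ t ∈ Icc (0:ℝ) 1, HasDerivWithinAt H (q t) (Icc (0:ℝ) 1) t := by
    rw [hH]; exact aux_ftc q hqc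
  have hH0 : H 0 = 0 := by simp [hH]
  have hE1 : E = Real.exp (P 1) := by rw [hE, hPt]
  have hrep : ∀ t ∈ Icc (0:ℝ) 1, (∫ s in (0:ℝ)..1, G t s * h s) +
      Real.exp (∫ η in (0:ℝ)..t, p η) / (lam - E) * Φ₀ =
      Real.exp (P t) * (H t + (E * H 1 + Φ₀) / (lam - E)) := by
    intro t ht
    have e1 : ∀ s ∈ Ioo (0:ℝ) t, G t s * h s = Real.exp (P t) / (lam - E) * lam * q s := by
      intro s hs
      rw [hG, hPst s ⟨hs.1.le, hs.2.le.trans ht.2⟩ t ht, if_pos hs.2, sub_eq_add_neg (P t),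
        Real.exp_add, hq]
      ring
    have e2 : ∀ s ∈ Ioo t (1:ℝ), G t s * h s = Real.exp (P t) / (lam - E) * E * q s := by
      intro s hs
      rw [hG, hPst s ⟨ht.1.trans hs.1.le, hs.2.le⟩ t ht, if_neg (not_lt.2 hs.1.le),
        sub_eq_add_neg (P t), Real.exp_add, hq]
      ring
    have i1 := intervalIntegral.integral_congr_Ioo_of_le (μ := MeasureTheory.volume) ht.1 e1
    have i2 := intervalIntegral.integral_congr_Ioo_of_le (μ := MeasureTheory.volume) ht.2 e2
    have n1 : IntervalIntegrable (fun s => G t s * h s) MeasureTheory.volume 0 t := by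
      refine ((hii q hqc _ m0 _ ht).const_mul (Real.exp (P t) / (lam - E) * lam)).congr_uIoo ?_
      intro s hs
      rw [uIoo_of_le ht.1] at hs
      exact (e1 s hs).symm
    have n2 : IntervalIntegrable (fun s => G t s * h s) MeasureTheory.volume t 1 := by
      refine ((hii q hqc _ ht _ m1).const_mul (Real.exp (P t) / (lam - E) * E)).congr_uIoo ?_
      intro s hs
      rw [uIoo_of_le ht.2] at hs
      exact (e2 s hs).symm
    have hH1 : (∫ s in t..1, q s) = H 1 - H t := by
      rw [hH]
      exact (intervalIntegral.integral_interval_sub_left (hii q hqc _ m0 _ m1)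
        (hii q hqc _ m0 _ ht)).symm
    have hHt : (∫ s in (0:ℝ)..t, q s) = H t := by rw [hH]
    rw [← intervalIntegral.integral_add_adjacent_intervals n1 n2, i1, i2,
      intervalIntegral.integral_const_mul, intervalIntegral.integral_const_mul, hH1, hHt, hPt]
    field_simp
    ring
  obtain ⟨C, hC⟩ : ∃ C : ℝ, C = (E * H 1 + Φ₀) / (lam - E) := ⟨_, rfl⟩
  have hC2 : C * (lam - E) = E * H 1 + Φ₀ := by rw [hC]; field_simp
  have hexp : ∀ t, Real.exp (P t) * Real.exp (-P t) = 1 := by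
    intro t; rw [← Real.exp_add]; simp
  have hR : (∀ t ∈ Icc (0:ℝ) 1, y t =
      (∫ s in (0:ℝ)..1, G t s * h s) +
      Real.exp (∫ η in (0:ℝ)..t, p η) / (lam - E) * Φ₀) ↔
      (∀ t ∈ Icc (0:ℝ) 1, y t = Real.exp (P t) * (H t + C)) := by
    refine forall₂_congr fun t ht => ?_
    rw [hrep t ht, hC]
  rw [hR]
  constructor
  · rintro ⟨hode, hbc⟩
    have hu : ∀ t ∈ Icc (0:ℝ) 1, HasDerivWithinAt (fun x => Real.exp (-P x) * y x - H x) 0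
        (Icc (0:ℝ) 1) t := by
      intro t ht
      have := (((hPd t ht).fun_neg.exp).fun_mul (hyd t ht)).fun_sub (hHd t ht)
      have hz : Real.exp (-P t) * -p t * y t + Real.exp (-P t) * y' t - q t = 0 := by
        rw [hq]
        simp only []
        rw [← hode t ht]
        ring
      rw [hz] at this
      exact this
    have hconst : ∀ t ∈ Icc (0:ℝ) 1, Real.exp (-P t) * y t - H t = y 0 := by
      intro t ht
      have := (convex_Icc (0:ℝ) 1).is_const_of_fderivWithin_eq_zero (𝕜 := ℝ)
        (f := fun x => Real.exp (-P x) * y x - H x)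
        (fun x hx => (hu x hx).differentiableWithinAt) (fun x hx => by
          have h2 := (hu x hx).hasFDerivWithinAt.fderivWithin
            ((uniqueDiffOn_Icc zero_lt_one) x hx)
          rw [h2]; ext; simp) ht m0
      simpa [hP0, hH0] using this
    have hy : ∀ t ∈ Icc (0:ℝ) 1, y t = Real.exp (P t) * (H t + y 0) := by
      intro t ht
      rw [← hconst t ht]
      linear_combination (-y t) * hexp t
    have h1 := hy 1 m1
    rw [← hE1] at h1
    have : y 0 = C := by
      apply mul_right_cancel₀ hd
      rw [hC2]
      linear_combination hbc + h1
    rw [← this]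
    exact hy
  · intro hy
    constructor
    · intro t ht
      have h1 : HasDerivWithinAt (fun x => Real.exp (P x) * (H x + C)) _ (Icc (0:ℝ) 1) t :=
        ((hPd t ht).exp).fun_mul ((hHd t ht).add_const C)
      have h2 := h1.congr hy (hy t ht)
      have h3 := ((uniqueDiffOn_Icc zero_lt_one) t ht).eq_deriv _ (hyd t ht) h2
      rw [h3, hy t ht, hq]
      simp only []
      linear_combination (h t) * hexp t
    · rw [hy 0 m0, hy 1 m1, ← hE1, hP0, hH0, Real.exp_zero]
      linear_combination hC2
end

section
/- For every continuous y : [0,1] → [0,∞), the function Ky is nonnegative and nondecreasing on [0,1]; consequently ‖Ky‖ = (Ky)(1) and min_{t∈[0,1]} (Ky)(t) = (Ky)(0) ≥ ‖Ky‖/λ, where ‖·‖ is the supremum norm on C([0,1]). -/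
open Set

/-- For every continuous nonnegative `y`, `Ky` is nonnegative and nondecreasing on
`[0,1]`, `‖Ky‖ = (Ky)(1)`, and the minimum of `Ky` is `(Ky)(0) ≥ ‖Ky‖/λ`. -/
theorem K_monotone_properties
    (p : ℝ → ℝ) (hp : ContinuousOn p (Icc (0:ℝ) 1))
    (hp0 : ∀ t ∈ Icc (0:ℝ) 1, 0 ≤ p t)
    (E : ℝ) (hE : E = Real.exp (∫ η in (0:ℝ)..1, p η))
    (lam : ℝ) (hlam : E < lam)
    (n m : ℕ) (τ : Fin n → ℝ) (hτ : ∀ j, τ j ∈ Icc (0:ℝ) 1) (hτmono : StrictMono τ)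
    (f : Fin m → ℝ → ℝ → ℝ)
    (hfc : ∀ i, ContinuousOn (fun q : ℝ × ℝ => f i q.1 q.2) (Icc (0:ℝ) 1 ×ˢ Ici (0:ℝ)))
    (hf0 : ∀ i, ∀ t ∈ Icc (0:ℝ) 1, ∀ z ≥ (0:ℝ), 0 ≤ f i t z)
    (Φ : Fin n → ℝ → ℝ → ℝ)
    (hΦc : ∀ j, ContinuousOn (fun q : ℝ × ℝ => Φ j q.1 q.2) (Icc (0:ℝ) 1 ×ˢ Ici (0:ℝ)))
    (hΦ0 : ∀ j, ∀ t ∈ Icc (0:ℝ) 1, ∀ z ≥ (0:ℝ), 0 ≤ Φ j t z)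
    (G : ℝ → ℝ → ℝ)
    (hG : ∀ t s : ℝ, G t s =
      Real.exp (∫ η in s..t, p η) / (lam - E) * (if s < t then lam else E))
    (K : (ℝ → ℝ) → ℝ → ℝ)
    (hK : ∀ z : ℝ → ℝ, ∀ t : ℝ, K z t =
      (∫ s in (0:ℝ)..1, G t s * ∑ i, f i s (z s)) +
      Real.exp (∫ η in (0:ℝ)..t, p η) / (lam - E) * ∑ j, Φ j (τ j) (z (τ j)))
    (supnorm : (ℝ → ℝ) → ℝ)
    (hsup : ∀ z : ℝ → ℝ, supnorm z = sSup ((fun t => |z t|) '' Icc (0:ℝ) 1)) :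
    ∀ y : ℝ → ℝ, ContinuousOn y (Icc (0:ℝ) 1) → (∀ t ∈ Icc (0:ℝ) 1, 0 ≤ y t) →
      (∀ t ∈ Icc (0:ℝ) 1, 0 ≤ K y t) ∧
      MonotoneOn (K y) (Icc (0:ℝ) 1) ∧
      supnorm (K y) = K y 1 ∧
      (∀ t ∈ Icc (0:ℝ) 1, K y 0 ≤ K y t) ∧
      supnorm (K y) / lam ≤ K y 0 := by
  intro y hy hy0
  have hd : 0 < lam - E := by linarith
  have hE0 : 0 < E := by rw [hE]; exact Real.exp_pos _
  have hl0 : 0 < lam := by linarith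
  have hpi : ∀ a ∈ Icc (0:ℝ) 1, ∀ b ∈ Icc (0:ℝ) 1,
      IntervalIntegrable p MeasureTheory.volume a b := fun a ha b hb =>
    (hp.mono (uIcc_subset_Icc ha hb)).intervalIntegrable
  have h0 : (0:ℝ) ∈ Icc (0:ℝ) 1 := by simp
  have h1 : (1:ℝ) ∈ Icc (0:ℝ) 1 := by simp
  obtain ⟨P, hP⟩ : ∃ P : ℝ → ℝ, ∀ t, P t = ∫ η in (0:ℝ)..t, p η := ⟨_, fun _ => rfl⟩
  have hPd : ∀ a ∈ Icc (0:ℝ) 1, ∀ b ∈ Icc (0:ℝ) 1, (∫ η in a..b, p η) = P b - P a := by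
    intro a ha b hb
    rw [hP, hP, intervalIntegral.integral_interval_sub_left (hpi _ h0 _ hb) (hpi _ h0 _ ha)]
  have hPm : ∀ a ∈ Icc (0:ℝ) 1, ∀ b ∈ Icc (0:ℝ) 1, a ≤ b → P a ≤ P b := by
    intro a ha b hb hab
    have := hPd a ha b hb
    have h2 : 0 ≤ ∫ η in a..b, p η := intervalIntegral.integral_nonneg hab
      (fun u hu => hp0 u ⟨ha.1.trans hu.1, hu.2.trans hb.2⟩)
    linarith
  have hP0 : P 0 = 0 := by rw [hP]; simp
  have hEP : E = Real.exp (P 1) := by rw [hE, hP]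
  have hPc : ContinuousOn P (Icc (0:ℝ) 1) := by
    have := intervalIntegral.continuousOn_primitive_interval' (hpi 0 h0 1 h1) (by simp : (0:ℝ) ∈ uIcc (0:ℝ) 1)
    rw [uIcc_of_le zero_le_one] at this
    exact this.congr (fun t _ => hP t)
  obtain ⟨F, hF⟩ : ∃ F : ℝ → ℝ, ∀ s, F s = ∑ i, f i s (y s) := ⟨_, fun _ => rfl⟩
  have hFc : ContinuousOn F (Icc (0:ℝ) 1) := by
    have : ContinuousOn (fun s => ∑ i, f i s (y s)) (Icc (0:ℝ) 1) := by
      refine continuousOn_finsetSum _ fun i _ => ?_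
      exact (hfc i).comp (continuousOn_id.prodMk hy) (fun s hs => ⟨hs, hy0 s hs⟩)
    exact this.congr (fun t _ => hF t)
  have hF0 : ∀ s ∈ Icc (0:ℝ) 1, 0 ≤ F s := by
    intro s hs
    rw [hF]
    exact Finset.sum_nonneg fun i _ => hf0 i s hs _ (hy0 s hs)
  obtain ⟨S, hS⟩ : ∃ S : ℝ, S = ∑ j, Φ j (τ j) (y (τ j)) := ⟨_, rfl⟩
  have hS0 : 0 ≤ S := by
    rw [hS]
    exact Finset.sum_nonneg fun j _ => hΦ0 j _ (hτ j) _ (hy0 _ (hτ j))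
  have hK' : ∀ t, K y t = (∫ s in (0:ℝ)..1, G t s * F s) + Real.exp (P t) / (lam - E) * S := by
    intro t
    rw [hK, hS, hP]
    simp only [hF]
  have hG' : ∀ t ∈ Icc (0:ℝ) 1, ∀ s ∈ Icc (0:ℝ) 1, G t s =
      Real.exp (P t - P s) / (lam - E) * (if s < t then lam else E) := by
    intro t ht s hs
    rw [hG, hPd s hs t ht]
  have hG0 : ∀ t s, 0 ≤ G t s := by
    intro t s
    rw [hG]
    have : 0 ≤ (if s < t then lam else E) := by split_ifs <;> linarith
    positivity
  have hGm : ∀ a ∈ Icc (0:ℝ) 1, ∀ b ∈ Icc (0:ℝ) 1, a ≤ b → ∀ s ∈ Icc (0:ℝ) 1, G a s ≤ G b s := by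
    intro a ha b hb hab s hs
    rw [hG' a ha s hs, hG' b hb s hs]
    have h2 := hPm a ha b hb hab
    have h3 : (if s < a then lam else E) ≤ (if s < b then lam else E) := by
      split_ifs <;> linarith
    have h4 : 0 ≤ (if s < a then lam else E) := by split_ifs <;> linarith
    gcongr
  have hGl : ∀ s ∈ Icc (0:ℝ) 1, G 1 s ≤ lam * G 0 s := by
    intro s hs
    rw [hG' 1 h1 s hs, hG' 0 h0 s hs, if_neg (not_lt.2 hs.1), hP0]
    have h3 : (if s < 1 then lam else E) ≤ lam := by split_ifs <;> linarith
    have e : lam * (Real.exp (0 - P s) / (lam - E) * E) =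
      Real.exp (P 1 - P s) / (lam - E) * lam := by
      rw [sub_eq_add_neg (P 1), Real.exp_add, ← hEP, zero_sub]; ring
    rw [e]
    gcongr
  have hint : ∀ t ∈ Icc (0:ℝ) 1,
      IntervalIntegrable (fun s => G t s * F s) MeasureTheory.volume 0 1 := by
    intro t ht
    rw [intervalIntegrable_iff_integrableOn_Icc_of_le zero_le_one]
    have hc : ContinuousOn (fun s => Real.exp (P t - P s) / (lam - E) * F s) (Icc (0:ℝ) 1) :=
      (((continuousOn_const.sub hPc).rexp).div_const _).mul hFc
    have hi := hc.integrableOn_Icc (μ := MeasureTheory.volume)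
    have hi2 := MeasureTheory.IntegrableOn.indicator hi (measurableSet_Iio (a := t))
    refine MeasureTheory.IntegrableOn.congr_fun
      (MeasureTheory.Integrable.add (hi.const_mul E) (hi2.const_mul (lam - E))) ?_ measurableSet_Icc
    intro s hs
    simp only [Pi.add_apply, indicator, mem_Iio]
    rw [hG' t ht s hs]
    split_ifs <;> ring
  have hmono : MonotoneOn (K y) (Icc (0:ℝ) 1) := by
    intro a ha b hb hab
    rw [hK', hK']
    have h2 := hPm a ha b hb hab
    refine add_le_add ?_ (by gcongr)
    exact intervalIntegral.integral_mono_on zero_le_one (hint a ha) (hint b hb)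
      fun s hs => mul_le_mul_of_nonneg_right (hGm a ha b hb hab s hs) (hF0 s hs)
  have hnn : ∀ t ∈ Icc (0:ℝ) 1, 0 ≤ K y t := by
    intro t ht
    rw [hK']
    have : 0 ≤ ∫ s in (0:ℝ)..1, G t s * F s := intervalIntegral.integral_nonneg zero_le_one
      fun s hs => mul_nonneg (hG0 t s) (hF0 s hs)
    positivity
  have hsn : supnorm (K y) = K y 1 := by
    rw [hsup]
    refine IsGreatest.csSup_eq ⟨⟨1, h1, abs_of_nonneg (hnn 1 h1)⟩, ?_⟩
    rintro _ ⟨t, ht, rfl⟩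
    simp only [abs_of_nonneg (hnn t ht)]
    exact hmono ht h1 ht.2
  refine ⟨hnn, hmono, hsn, fun t ht => hmono h0 ht ht.1, ?_⟩
  rw [hsn, div_le_iff₀ hl0, hK', hK', add_mul, hP0, ← hEP, Real.exp_zero,
    ← intervalIntegral.integral_mul_const]
  refine add_le_add ?_ ?_
  · refine intervalIntegral.integral_mono_on zero_le_one (hint 1 h1) ((hint 0 h0).mul_const lam) ?_
    intro s hs
    have := mul_le_mul_of_nonneg_right (hGl s hs) (hF0 s hs)
    linarith
  · have : 1 / (lam - E) * S * lam = lam / (lam - E) * S := by ring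
    rw [this]
    gcongr
end

section
/- The operator K maps the cone P := {y ∈ C([0,1],ℝ) : y(t) ≥ 0 for all t ∈ [0,1], y is nondecreasing, and y(0) ≥ ‖y‖/λ} into itself, and K : P → P is completely continuous (continuous and mapping bounded subsets of P into relatively compact sets in C([0,1]) with the supremum norm). -/
open Set


lemma lipBall_isCompact (M : ℝ) : IsCompact {v : C(Icc (0:ℝ) 1, ℝ) |
    (∀ t, |v t| ≤ M) ∧ ∀ s t, |v s - v t| ≤ M * |(s:ℝ) - t|} := by
  have key : ∀ g : Icc (0:ℝ) 1 → ℝ, (∀ s t, |g s - g t| ≤ M * |(s:ℝ) - t|) → 0 ≤ M →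
      LipschitzWith M.toNNReal g := by
    intro g hg hM
    apply LipschitzWith.of_dist_le_mul
    intro x y
    rw [Real.coe_toNNReal _ hM, Real.dist_eq, Subtype.dist_eq, Real.dist_eq]
    exact hg x y
  rcases lt_or_ge M 0 with hM | hM
  · convert isCompact_empty
    ext v
    simp only [mem_setOf_eq, mem_empty_iff_false, iff_false]
    rintro ⟨h, -⟩
    have := h ⟨0, by norm_num⟩
    have := abs_nonneg (v ⟨0, by norm_num⟩)
    linarith
  apply ArzelaAscoli.isCompact_of_equicontinuous
  · have himg : (ContinuousMap.toFun '' {v : C(Icc (0:ℝ) 1, ℝ) |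
        (∀ t, |v t| ≤ M) ∧ ∀ s t, |v s - v t| ≤ M * |(s:ℝ) - t|}) =
        {g : Icc (0:ℝ) 1 → ℝ | (∀ t, |g t| ≤ M) ∧ ∀ s t, |g s - g t| ≤ M * |(s:ℝ) - t|} := by
      ext g
      constructor
      · rintro ⟨v, hv, rfl⟩
        exact hv
      · intro hg
        exact ⟨⟨g, (key g hg.2 hM).continuous⟩, hg, rfl⟩
    rw [himg]
    apply IsCompact.of_isClosed_subset
      (isCompact_univ_pi (fun _ : Icc (0:ℝ) 1 => isCompact_Icc (a := -M) (b := M)))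
    · simp only [setOf_and, setOf_forall]
      refine IsClosed.inter (isClosed_iInter fun t => ?_)
        (isClosed_iInter fun s => isClosed_iInter fun t => ?_)
      · exact isClosed_le (by fun_prop) (by fun_prop)
      · exact isClosed_le (by fun_prop) (by fun_prop)
    · intro g hg t _
      exact abs_le.1 (hg.1 t)
  · apply UniformEquicontinuous.equicontinuous
    exact LipschitzWith.uniformEquicontinuous _ M.toNNReal (fun v => key _ v.2.2 hM)

lemma clamp_continuous (g : ℝ → ℝ → ℝ)
    (hg : ContinuousOn (fun q : ℝ × ℝ => g q.1 q.2) (Icc (0:ℝ) 1 ×ˢ Ici (0:ℝ))) :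
    Continuous (fun q : ℝ × ℝ => g (projIcc (0:ℝ) 1 zero_le_one q.1) (max q.2 0)) := by
  have : Continuous (fun q : ℝ × ℝ => ((projIcc (0:ℝ) 1 zero_le_one q.1 : ℝ), max q.2 0)) := by
    have := continuous_projIcc (h := zero_le_one' ℝ)
    fun_prop
  exact hg.comp_continuous this (fun q => ⟨Subtype.coe_prop _, mem_Ici.2 (le_max_right _ _)⟩)

/-- The operator `K` maps the cone
`P = {y ∈ C([0,1]) : y ≥ 0, y nondecreasing, y(0) ≥ ‖y‖/λ}` into itself and is
completely continuous on `P`. -/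
theorem K_maps_cone_completely_continuous
    (p : ℝ → ℝ) (hp : ContinuousOn p (Icc (0:ℝ) 1))
    (hp0 : ∀ t ∈ Icc (0:ℝ) 1, 0 ≤ p t)
    (E : ℝ) (hE : E = Real.exp (∫ η in (0:ℝ)..1, p η))
    (lam : ℝ) (hlam : E < lam)
    (n m : ℕ) (τ : Fin n → ℝ) (hτ : ∀ j, τ j ∈ Icc (0:ℝ) 1) (hτmono : StrictMono τ)
    (f : Fin m → ℝ → ℝ → ℝ)
    (hfc : ∀ i, ContinuousOn (fun q : ℝ × ℝ => f i q.1 q.2) (Icc (0:ℝ) 1 ×ˢ Ici (0:ℝ)))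
    (hf0 : ∀ i, ∀ t ∈ Icc (0:ℝ) 1, ∀ z ≥ (0:ℝ), 0 ≤ f i t z)
    (Φ : Fin n → ℝ → ℝ → ℝ)
    (hΦc : ∀ j, ContinuousOn (fun q : ℝ × ℝ => Φ j q.1 q.2) (Icc (0:ℝ) 1 ×ˢ Ici (0:ℝ)))
    (hΦ0 : ∀ j, ∀ t ∈ Icc (0:ℝ) 1, ∀ z ≥ (0:ℝ), 0 ≤ Φ j t z)
    (G : ℝ → ℝ → ℝ)
    (hG : ∀ t s : ℝ, G t s =
      Real.exp (∫ η in s..t, p η) / (lam - E) * (if s < t then lam else E))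
    -- the operator K on C([0,1], ℝ)
    (K : C(Icc (0:ℝ) 1, ℝ) → C(Icc (0:ℝ) 1, ℝ))
    (hK : ∀ y : C(Icc (0:ℝ) 1, ℝ), ∀ t : Icc (0:ℝ) 1, K y t =
      (∫ s in (0:ℝ)..1, G (t:ℝ) s * ∑ i, f i s (y (projIcc 0 1 zero_le_one s))) +
      Real.exp (∫ η in (0:ℝ)..(t:ℝ), p η) / (lam - E) *
        ∑ j, Φ j (τ j) (y (projIcc 0 1 zero_le_one (τ j))))
    -- the cone P
    (P : Set C(Icc (0:ℝ) 1, ℝ))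
    (hP : P = {y : C(Icc (0:ℝ) 1, ℝ) |
      (∀ t, 0 ≤ y t) ∧ Monotone y ∧ ‖y‖ / lam ≤ y ⟨0, by norm_num⟩}) :
    (∀ y ∈ P, K y ∈ P) ∧
    ContinuousOn K P ∧
    (∀ s ⊆ P, Bornology.IsBounded s → IsCompact (closure (K '' s))) := by
  -- globalised data
  set q : ℝ → ℝ := IccExtend (zero_le_one' ℝ) ((Icc (0:ℝ) 1).restrict p) with hq
  have hqc : Continuous q := (continuousOn_iff_continuous_restrict.1 hp).Icc_extend'
  have hqp : ∀ t ∈ Icc (0:ℝ) 1, q t = p t := fun t ht => by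
    rw [hq, IccExtend_of_mem _ _ ht]; rfl
  have hq0 : ∀ t, 0 ≤ q t := fun t => hp0 _ (Subtype.coe_prop _)
  have hqi : ∀ a b : ℝ, IntervalIntegrable q MeasureTheory.volume a b :=
    fun a b => hqc.intervalIntegrable a b
  have hint : ∀ a ∈ Icc (0:ℝ) 1, ∀ b ∈ Icc (0:ℝ) 1, (∫ η in a..b, p η) = ∫ η in a..b, q η := by
    intro a ha b hb
    apply intervalIntegral.integral_congr
    intro x hx
    exact (hqp x (uIcc_subset_Icc ha hb hx)).symm
  have h0m : (0:ℝ) ∈ Icc (0:ℝ) 1 := by norm_num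
  have h1m : (1:ℝ) ∈ Icc (0:ℝ) 1 := by norm_num
  obtain ⟨A, hA⟩ : ∃ A : ℝ → ℝ, ∀ t, A t = ∫ η in (0:ℝ)..t, q η := ⟨_, fun _ => rfl⟩
  have hAc : Continuous A := by
    rw [show A = fun t => ∫ η in (0:ℝ)..t, q η from funext hA]
    exact intervalIntegral.continuous_primitive hqi 0
  have hAm : Monotone A := by
    intro a b hab
    have := intervalIntegral.integral_add_adjacent_intervals (hqi 0 a) (hqi a b)
    have h2 := intervalIntegral.integral_nonneg (μ := MeasureTheory.volume) hab (fun x _ => hq0 x)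
    rw [hA, hA]; linarith
  have hA0 : A 0 = 0 := by rw [hA]; simp
  have hEA : E = Real.exp (A 1) := by rw [hE, hA, hint 0 h0m 1 h1m]
  have hE1 : 1 ≤ E := by
    rw [hEA]; apply Real.one_le_exp; rw [← hA0]; exact hAm zero_le_one
  have hd : 0 < lam - E := by linarith
  have hlam0 : 0 < lam := by linarith
  have hGA : ∀ t ∈ Icc (0:ℝ) 1, ∀ s ∈ Icc (0:ℝ) 1,
      G t s = Real.exp (A t) * Real.exp (-A s) / (lam - E) * (if s < t then lam else E) := by
    intro t ht s hs
    rw [hG, ← Real.exp_add, hint s hs t ht]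
    have := intervalIntegral.integral_add_adjacent_intervals (hqi 0 s) (hqi s t)
    rw [hA, hA, ← this]
    congr 3
    ring
  -- the nonlinearities
  obtain ⟨H, hH⟩ : ∃ H : ℝ × ℝ → ℝ, ∀ x, H x =
      (∑ i, f i (projIcc (0:ℝ) 1 zero_le_one x.1) (max x.2 0)) * Real.exp (-A x.1) :=
    ⟨_, fun _ => rfl⟩
  have hHc : Continuous H := by
    rw [show H = _ from funext hH]
    refine Continuous.mul (continuous_finsetSum _ fun i _ => clamp_continuous (f i) (hfc i)) ?_
    fun_prop
  have hH0 : ∀ x, 0 ≤ H x := by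
    intro x
    rw [hH]
    exact mul_nonneg (Finset.sum_nonneg fun i _ => hf0 i _ (Subtype.coe_prop _) _
      (le_max_right _ _)) (Real.exp_pos _).le
  obtain ⟨Ψ, hΨ⟩ : ∃ Ψ : (Fin n → ℝ) → ℝ, ∀ z, Ψ z =
      ∑ j, Φ j (projIcc (0:ℝ) 1 zero_le_one (τ j)) (max (z j) 0) := ⟨_, fun _ => rfl⟩
  have hΨc : Continuous Ψ := by
    rw [show Ψ = _ from funext hΨ]
    refine continuous_finsetSum _ fun j _ => ?_
    exact (clamp_continuous (Φ j) (hΦc j)).comp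
      (continuous_const.prodMk (continuous_apply j) : Continuous fun z : Fin n → ℝ => (τ j, z j))
  have hΨ0 : ∀ z, 0 ≤ Ψ z := by
    intro z
    rw [hΨ]
    exact Finset.sum_nonneg fun i _ => hΦ0 i _ (Subtype.coe_prop _) _ (le_max_right _ _)
  obtain ⟨h, hh⟩ : ∃ h : C(Icc (0:ℝ) 1, ℝ) → ℝ → ℝ, ∀ y s, h y s =
    H (s, y (projIcc 0 1 zero_le_one s)) := ⟨_, fun _ _ => rfl⟩
  have hhc2 : Continuous (fun x : C(Icc (0:ℝ) 1, ℝ) × ℝ => h x.1 x.2) := by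
    simp only [hh]
    have := continuous_projIcc (h := zero_le_one' ℝ)
    fun_prop
  have hhc : ∀ y, Continuous (h y) := fun y =>
    hhc2.comp (continuous_const.prodMk continuous_id)
  have hhi : ∀ y (a b : ℝ), IntervalIntegrable (h y) MeasureTheory.volume a b :=
    fun y a b => (hhc y).intervalIntegrable a b
  have hh0 : ∀ y s, 0 ≤ h y s := fun y s => by rw [hh]; exact hH0 _
  obtain ⟨S, hS⟩ : ∃ S : C(Icc (0:ℝ) 1, ℝ) → ℝ, ∀ y, S y =
    Ψ (fun j => y (projIcc 0 1 zero_le_one (τ j))) := ⟨_, fun _ => rfl⟩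
  have hSc : Continuous S := by
    rw [show S = _ from funext hS]
    fun_prop
  have hS0 : ∀ y, 0 ≤ S y := fun y => by rw [hS]; exact hΨ0 _
  obtain ⟨V, hV⟩ : ∃ V : C(Icc (0:ℝ) 1, ℝ) → ℝ → ℝ, ∀ y t, V y t =
    ∫ s in (0:ℝ)..t, h y s := ⟨_, fun _ _ => rfl⟩
  have hVc : Continuous (fun x : C(Icc (0:ℝ) 1, ℝ) × ℝ => V x.1 x.2) := by
    simp only [hV]
    exact intervalIntegral.continuous_parametric_primitive_of_continuous hhc2
  have hVm : ∀ y, Monotone (V y) := by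
    intro y a b hab
    have := intervalIntegral.integral_add_adjacent_intervals (hhi y 0 a) (hhi y a b)
    have h2 := intervalIntegral.integral_nonneg (μ := MeasureTheory.volume) hab
      (fun x _ => hh0 y x)
    rw [hV, hV]; linarith
  have hV0 : ∀ y, V y 0 = 0 := fun y => by rw [hV]; simp
  obtain ⟨c, hc⟩ : ∃ c : C(Icc (0:ℝ) 1, ℝ) → ℝ, ∀ y, c y =
    (E * V y 1 + S y) / (lam - E) := ⟨_, fun _ => rfl⟩
  have hcc : Continuous c := by
    rw [show c = _ from funext hc]
    have : Continuous fun y => V y 1 := hVc.comp (continuous_id.prodMk continuous_const)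
    fun_prop
  -- the formula
  have hform : ∀ y : C(Icc (0:ℝ) 1, ℝ), (∀ t, 0 ≤ y t) → ∀ t : Icc (0:ℝ) 1,
      K y t = Real.exp (A t) * V y t + Real.exp (A t) * c y := by
    intro y hy t
    have ht := t.2
    have hSy : ∑ j, Φ j (τ j) (y (projIcc 0 1 zero_le_one (τ j))) = S y := by
      rw [hS, hΨ]
      refine Finset.sum_congr rfl fun j _ => ?_
      rw [max_eq_left (hy _), projIcc_of_mem _ (hτ j)]
    have hF : ∀ s ∈ Icc (0:ℝ) 1, Real.exp (-A s) *
        ∑ i, f i s (y (projIcc 0 1 zero_le_one s)) = h y s := by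
      intro s hs
      rw [hh, hH, mul_comm]
      congr 1
      refine Finset.sum_congr rfl fun j _ => ?_
      simp only
      rw [max_eq_left (hy _), projIcc_of_mem _ hs]
    have e1 : EqOn (fun s => (Real.exp (A t) / (lam - E) * lam) * h y s)
        (fun s => G (t:ℝ) s * ∑ i, f i s (y (projIcc 0 1 zero_le_one s))) (uIoo 0 (t:ℝ)) := by
      intro s hs
      rw [uIoo_of_le ht.1] at hs
      have hs' : s ∈ Icc (0:ℝ) 1 := ⟨hs.1.le, hs.2.le.trans ht.2⟩
      simp only
      rw [hGA t ht s hs', if_pos hs.2, ← hF s hs']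
      ring
    have e2 : EqOn (fun s => (Real.exp (A t) / (lam - E) * E) * h y s)
        (fun s => G (t:ℝ) s * ∑ i, f i s (y (projIcc 0 1 zero_le_one s))) (uIoo (t:ℝ) 1) := by
      intro s hs
      rw [uIoo_of_le ht.2] at hs
      have hs' : s ∈ Icc (0:ℝ) 1 := ⟨ht.1.trans hs.1.le, hs.2.le⟩
      simp only
      rw [hGA t ht s hs', if_neg (not_lt.2 hs.1.le), ← hF s hs']
      ring
    have i1 := ((hhi y 0 t).const_mul (Real.exp (A t) / (lam - E) * lam)).congr_uIoo e1
    have i2 := ((hhi y t 1).const_mul (Real.exp (A t) / (lam - E) * E)).congr_uIoo e2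
    have hadd := intervalIntegral.integral_add_adjacent_intervals (hhi y 0 t) (hhi y t 1)
    rw [hK, hSy, ← intervalIntegral.integral_add_adjacent_intervals i1 i2,
      ← intervalIntegral.integral_congr_uIoo e1, ← intervalIntegral.integral_congr_uIoo e2,
      intervalIntegral.integral_const_mul, intervalIntegral.integral_const_mul,
      hint 0 h0m t ht, ← hA, hc, hV, hV, ← hadd]
    field_simp
    ring
  have hc0 : ∀ y, 0 ≤ c y := by
    intro y
    rw [hc]
    have := hVm y (zero_le_one' ℝ)
    rw [hV0] at this
    have := hS0 y
    positivity
  have hP0 : ∀ y ∈ P, ∀ t, 0 ≤ y t := by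
    intro y hy
    rw [hP] at hy
    exact hy.1
  have hVn : ∀ y, ∀ t : Icc (0:ℝ) 1, 0 ≤ V y t := by
    intro y t
    have := hVm y t.2.1
    rwa [hV0] at this
  refine ⟨?_, ?_, ?_⟩
  · intro y hy
    have hy0 := hP0 y hy
    have hnn : ∀ t, 0 ≤ K y t := by
      intro t
      rw [hform y hy0 t]
      have := hVn y t
      have := hc0 y
      positivity
    have hmono : Monotone (K y) := by
      intro a b hab
      rw [hform y hy0 a, hform y hy0 b, ← mul_add, ← mul_add]
      have h1 : V y a ≤ V y b := hVm y hab
      have h2 : Real.exp (A a) ≤ Real.exp (A b) := Real.exp_le_exp.2 (hAm hab)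
      have := hVn y a
      have := hc0 y
      gcongr
    rw [hP]
    refine ⟨hnn, hmono, ?_⟩
    rw [div_le_iff₀ hlam0]
    have hK0 : K y ⟨0, by norm_num⟩ = c y := by
      rw [hform y hy0]; simp [hA0, hV0]
    have hK1 : K y ⟨1, by norm_num⟩ = E * V y 1 + E * c y := by
      rw [hform y hy0, hEA]
    have hle : K y ⟨1, by norm_num⟩ ≤ K y ⟨0, by norm_num⟩ * lam := by
      rw [hK0, hK1]
      have : c y * (lam - E) = E * V y 1 + S y := by rw [hc]; field_simp
      have := hS0 y
      linarith
    refine ((ContinuousMap.norm_le _ ((hnn _).trans hle)).2 fun t => ?_)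
    rw [Real.norm_eq_abs, abs_of_nonneg (hnn t)]
    have h1 : t ≤ (⟨1, by norm_num⟩ : Icc (0:ℝ) 1) := t.2.2
    exact (hmono h1).trans hle
  · apply ContinuousMap.continuousOn_of_continuousOn_uncurry
    have hcont : Continuous (fun x : C(Icc (0:ℝ) 1, ℝ) × Icc (0:ℝ) 1 =>
        Real.exp (A x.2) * V x.1 x.2 + Real.exp (A x.2) * c x.1) := by
      have : Continuous fun x : C(Icc (0:ℝ) 1, ℝ) × Icc (0:ℝ) 1 => V x.1 x.2 :=
        hVc.comp (continuous_fst.prodMk (continuous_subtype_val.comp continuous_snd))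
      fun_prop
    refine hcont.continuousOn.congr ?_
    rintro ⟨y, t⟩ hyt
    exact hform y (hP0 y hyt.1) t
  · intro s hs hb
    obtain ⟨R, hR⟩ := hb.exists_norm_le
    obtain ⟨M, hM⟩ := ((isCompact_Icc (a := (0:ℝ)) (b := 1)).prod
      (isCompact_Icc (a := -R) (b := R))).exists_bound_of_continuousOn hHc.continuousOn
    obtain ⟨N, hN⟩ := (isCompact_closedBall (0 : Fin n → ℝ) R).exists_bound_of_continuousOn
      hΨc.continuousOn
    have hyR : ∀ y ∈ s, ∀ t, |y t| ≤ R := fun y hy t =>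
      (y.norm_coe_le_norm t).trans (hR y hy)
    have hhM : ∀ y ∈ s, ∀ t ∈ Icc (0:ℝ) 1, |h y t| ≤ M := by
      intro y hy t ht
      rw [hh]
      exact hM _ ⟨ht, abs_le.1 (hyR y hy _)⟩
    have hSN : ∀ y ∈ s, S y ≤ N := by
      intro y hy
      rw [hS]
      refine (le_abs_self _).trans (hN _ ?_)
      rw [mem_closedBall_zero_iff]
      exact (pi_norm_le_iff_of_nonneg ((norm_nonneg _).trans (hR y hy))).2 fun j => hyR y hy _
    have hlip : ∀ y ∈ s, ∀ a ∈ Icc (0:ℝ) 1, ∀ b ∈ Icc (0:ℝ) 1,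
        |V y a - V y b| ≤ M * |a - b| := by
      intro y hy a ha b hb
      rw [hV, hV, intervalIntegral.integral_interval_sub_left (hhi _ _ _) (hhi _ _ _),
        ← Real.norm_eq_abs]
      apply intervalIntegral.norm_integral_le_of_norm_le_const
      intro x hx
      exact hhM y hy x (uIcc_subset_Icc hb ha (uIoc_subset_uIcc hx))
    have hVM : ∀ y ∈ s, ∀ a ∈ Icc (0:ℝ) 1, |V y a| ≤ M := by
      intro y hy a ha
      have h1 := hlip y hy a ha 0 h0m
      have h2 : 0 ≤ M := (abs_nonneg _).trans (hhM y hy 0 h0m)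
      rw [hV0, sub_zero, sub_zero, abs_of_nonneg ha.1] at h1
      nlinarith [ha.2]
    let e : C(Icc (0:ℝ) 1, ℝ) := ⟨fun t => Real.exp (A t), by fun_prop⟩
    let T : C(Icc (0:ℝ) 1, ℝ) × ℝ → C(Icc (0:ℝ) 1, ℝ) := fun x => e * x.1 + x.2 • e
    have hT : Continuous T := by fun_prop
    have hcomp := ((lipBall_isCompact M).prod
      (isCompact_Icc (a := (0:ℝ)) (b := (E * M + N) / (lam - E)))).image hT
    refine hcomp.closure_of_subset ?_
    rintro _ ⟨y, hy, rfl⟩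
    refine ⟨(⟨fun t => V y t, ?_⟩, c y), ⟨⟨fun t => hVM y hy t t.2, fun a b =>
      hlip y hy a a.2 b b.2⟩, hc0 y, ?_⟩, ?_⟩
    · exact hVc.comp (continuous_const.prodMk continuous_subtype_val)
    · simp only
      rw [hc]
      have := (le_abs_self _).trans (hVM y hy 1 h1m)
      have := hSN y hy
      gcongr
    · ext t
      rw [hform y (hP0 y (hs hy)) t]
      simp [T, e, mul_comm]
end

section
/- Assume 0 ≤ y·φ_j(t,y) ≤ Φ_j(t,y) ≤ y·ψ_j(t,y) for all t ∈ [0,1], y ∈ [0,∞), j = 1,…,n, and λ > (1 + Σ_{j=1}^n β_j)·E. If f_i(t,y) ≤ MC/m for all t ∈ [0,1], y ∈ [0,C], and all i = 1,…,m, then for every continuous y : [0,1] → [0,∞) with ‖y‖ ≤ C one has ‖Ky‖ ≤ C; that is, K maps {y ∈ C([0,1],[0,∞)) : ‖y‖ ≤ C} into itself. -/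
open Set

/-- Under (F₃), the operator `K` maps the ball `{y ≥ 0 : ‖y‖ ≤ C}` into itself. -/
theorem K_maps_ball_into_ball
    (p : ℝ → ℝ) (hp : ContinuousOn p (Icc (0:ℝ) 1))
    (hp0 : ∀ t ∈ Icc (0:ℝ) 1, 0 ≤ p t)
    (E : ℝ) (hE : E = Real.exp (∫ η in (0:ℝ)..1, p η))
    (lam : ℝ)
    (n m : ℕ) (τ : Fin n → ℝ) (hτ : ∀ j, τ j ∈ Icc (0:ℝ) 1) (hτmono : StrictMono τ)
    (f : Fin m → ℝ → ℝ → ℝ)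
    (hfc : ∀ i, ContinuousOn (fun q : ℝ × ℝ => f i q.1 q.2) (Icc (0:ℝ) 1 ×ˢ Ici (0:ℝ)))
    (hf0 : ∀ i, ∀ t ∈ Icc (0:ℝ) 1, ∀ z ≥ (0:ℝ), 0 ≤ f i t z)
    (Φ φ ψ : Fin n → ℝ → ℝ → ℝ)
    (hφc : ∀ j, ContinuousOn (fun q : ℝ × ℝ => φ j q.1 q.2) (Icc (0:ℝ) 1 ×ˢ Ici (0:ℝ)))
    (hψc : ∀ j, ContinuousOn (fun q : ℝ × ℝ => ψ j q.1 q.2) (Icc (0:ℝ) 1 ×ˢ Ici (0:ℝ)))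
    (hφpos : ∀ j, ∀ t ∈ Icc (0:ℝ) 1, ∀ z ≥ (0:ℝ), 0 < φ j t z)
    (hψpos : ∀ j, ∀ t ∈ Icc (0:ℝ) 1, ∀ z ≥ (0:ℝ), 0 < ψ j t z)
    (hΦ : ∀ j, ∀ t ∈ Icc (0:ℝ) 1, ∀ z ≥ (0:ℝ),
      0 ≤ z * φ j t z ∧ z * φ j t z ≤ Φ j t z ∧ Φ j t z ≤ z * ψ j t z)
    (C : ℝ) (hC : 0 < C)
    (β : Fin n → ℝ)
    (hβ : ∀ j, β j = sSup ((fun q : ℝ × ℝ => ψ j q.1 q.2) ''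
      (Icc (0:ℝ) 1 ×ˢ Icc (0:ℝ) C)))
    (hlam : (1 + ∑ j, β j) * E < lam)
    (G : ℝ → ℝ → ℝ)
    (hG : ∀ t s : ℝ, G t s =
      Real.exp (∫ η in s..t, p η) / (lam - E) * (if s < t then lam else E))
    (M : ℝ)
    (hM : M = (1 / ∫ s in (0:ℝ)..1, G 1 s) * (1 - E * (∑ j, β j) / (lam - E)))
    (K : (ℝ → ℝ) → ℝ → ℝ)
    (hK : ∀ z : ℝ → ℝ, ∀ t : ℝ, K z t =
      (∫ s in (0:ℝ)..1, G t s * ∑ i, f i s (z s)) +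
      Real.exp (∫ η in (0:ℝ)..t, p η) / (lam - E) * ∑ j, Φ j (τ j) (z (τ j)))
    (supnorm : (ℝ → ℝ) → ℝ)
    (hsup : ∀ z : ℝ → ℝ, supnorm z = sSup ((fun t => |z t|) '' Icc (0:ℝ) 1))
    (hF3 : ∀ i, ∀ t ∈ Icc (0:ℝ) 1, ∀ z ∈ Icc (0:ℝ) C, f i t z ≤ M * C / m) :
    ∀ y : ℝ → ℝ, ContinuousOn y (Icc (0:ℝ) 1) → (∀ t ∈ Icc (0:ℝ) 1, 0 ≤ y t) →
      supnorm y ≤ C → supnorm (K y) ≤ C := by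
  intro y hy hy0 hyC
  have h01 : (0:ℝ) ∈ Icc (0:ℝ) 1 := by simp
  have h11 : (1:ℝ) ∈ Icc (0:ℝ) 1 := by simp
  have hpi : ∀ a ∈ Icc (0:ℝ) 1, ∀ b ∈ Icc (0:ℝ) 1,
      IntervalIntegrable p MeasureTheory.volume a b := by
    intro a ha b hb
    apply ContinuousOn.intervalIntegrable
    exact hp.mono (uIcc_subset_Icc ha hb)
  obtain ⟨P, hP⟩ : ∃ P : ℝ → ℝ, ∀ t, P t = ∫ η in (0:ℝ)..t, p η := ⟨_, fun _ => rfl⟩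
  have hPsub : ∀ a ∈ Icc (0:ℝ) 1, ∀ b ∈ Icc (0:ℝ) 1, (∫ η in a..b, p η) = P b - P a := by
    intro a ha b hb
    rw [hP, hP, intervalIntegral.integral_interval_sub_left (hpi 0 h01 b hb) (hpi 0 h01 a ha)]
  have hPmono : ∀ a ∈ Icc (0:ℝ) 1, ∀ b ∈ Icc (0:ℝ) 1, a ≤ b → P a ≤ P b := by
    intro a ha b hb hab
    have h : 0 ≤ ∫ η in a..b, p η :=
      intervalIntegral.integral_nonneg hab
        (fun u hu => hp0 u ⟨ha.1.trans hu.1, hu.2.trans hb.2⟩)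
    rw [hPsub a ha b hb] at h
    linarith
  have hPc : ContinuousOn P (Icc (0:ℝ) 1) := by
    have h := intervalIntegral.continuousOn_primitive_interval (a := (0:ℝ)) (b := 1) (f := p)
      (μ := MeasureTheory.volume) (by
        rw [uIcc_of_le zero_le_one]
        exact hp.integrableOn_Icc)
    rw [uIcc_of_le zero_le_one] at h
    exact h.congr (fun t _ => hP t)
  have hP0 : P 0 = 0 := by rw [hP]; simp
  have hE1 : E = Real.exp (P 1) := by rw [hE, hP]
  have hEge : 1 ≤ E := by
    rw [hE1]
    apply Real.one_le_exp
    have := hPmono 0 h01 1 h11 zero_le_one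
    linarith
  have hβ0 : ∀ j, 0 ≤ β j := by
    intro j
    rw [hβ j]
    apply Real.sSup_nonneg
    rintro _ ⟨q, hq, rfl⟩
    exact (hψpos j q.1 hq.1 q.2 hq.2.1).le
  have hβle : ∀ j, ∀ t ∈ Icc (0:ℝ) 1, ∀ z ∈ Icc (0:ℝ) C, ψ j t z ≤ β j := by
    intro j t ht z hz
    rw [hβ j]
    apply le_csSup
    · apply (IsCompact.image_of_continuousOn (isCompact_Icc.prod isCompact_Icc) _).bddAbove
      exact (hψc j).mono (prod_mono le_rfl (fun x hx => hx.1))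
    · exact ⟨(t, z), ⟨ht, hz⟩, rfl⟩
  have hyle : ∀ t ∈ Icc (0:ℝ) 1, y t ≤ C := by
    intro t ht
    refine (le_abs_self _).trans (le_trans ?_ hyC)
    rw [hsup]
    exact le_csSup (isCompact_Icc.image_of_continuousOn hy.abs).bddAbove ⟨t, ht, rfl⟩
  obtain ⟨B, hB⟩ : ∃ B, B = ∑ j, β j := ⟨_, rfl⟩
  have hB0 : 0 ≤ B := by rw [hB]; exact Finset.sum_nonneg (fun j _ => hβ0 j)
  rw [← hB] at hlam hM
  have hBE : 0 ≤ B * E := by positivity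
  have hD : 0 < lam - E := by nlinarith
  have hlamE : E ≤ lam := by linarith
  have hlam0 : 0 < lam := by linarith
  obtain ⟨h, hh⟩ : ∃ h : ℝ → ℝ, ∀ s, h s = Real.exp (P 1 - P s) / (lam - E) * lam :=
    ⟨_, fun _ => rfl⟩
  have hhc : ContinuousOn h (Icc (0:ℝ) 1) := by
    have : h = fun s => Real.exp (P 1 - P s) / (lam - E) * lam := funext hh
    rw [this]
    exact (((continuousOn_const.sub hPc).rexp).div_const _).mul_const _
  have hhi : IntervalIntegrable h MeasureTheory.volume 0 1 := by
    apply ContinuousOn.intervalIntegrable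
    rwa [uIcc_of_le zero_le_one]
  have hhpos : ∀ s, 0 < h s := by
    intro s; rw [hh]; positivity
  have hI : (∫ s in (0:ℝ)..1, G 1 s) = ∫ s in (0:ℝ)..1, h s := by
    apply intervalIntegral.integral_congr_Ioo_of_le zero_le_one
    intro s hs
    have hs' : s ∈ Icc (0:ℝ) 1 := Ioo_subset_Icc_self hs
    simp only [hG, hh, hPsub s hs' 1 h11, if_pos hs.2]
  have hIpos : 0 < ∫ s in (0:ℝ)..1, h s :=
    intervalIntegral.intervalIntegral_pos_of_pos_on hhi (fun s _ => hhpos s) zero_lt_one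
  rw [hI] at hM
  obtain ⟨I, hIdef⟩ : ∃ I, I = ∫ s in (0:ℝ)..1, h s := ⟨_, rfl⟩
  rw [← hIdef] at hM hIpos
  have hMI : M * I = 1 - E * B / (lam - E) := by
    rw [hM]; field_simp
  have hM0 : 0 ≤ M := by
    rw [hM]
    apply mul_nonneg (by positivity)
    rw [sub_nonneg, div_le_one hD]
    nlinarith
  have hGle : ∀ t ∈ Icc (0:ℝ) 1, ∀ s ∈ Icc (0:ℝ) 1, G t s ≤ h s := by
    intro t ht s hs
    rw [hG, hh, hPsub s hs t ht]
    have h1 := hPmono t ht 1 h11 ht.2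
    have h2 : Real.exp (P t - P s) / (lam - E) ≤ Real.exp (P 1 - P s) / (lam - E) := by
      gcongr
    apply mul_le_mul h2 _ _ (by positivity)
    · split_ifs
      · exact le_rfl
      · exact hlamE
    · split_ifs <;> linarith
  have hG0 : ∀ t s : ℝ, 0 ≤ G t s := by
    intro t s
    rw [hG]
    apply mul_nonneg (by positivity)
    split_ifs <;> linarith
  have hS0 : ∀ s ∈ Icc (0:ℝ) 1, 0 ≤ ∑ i, f i s (y s) := fun s hs =>
    Finset.sum_nonneg (fun i _ => hf0 i s hs _ (hy0 s hs))
  have hSle : ∀ s ∈ Icc (0:ℝ) 1, ∑ i, f i s (y s) ≤ M * C := by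
    intro s hs
    have h1 : ∑ i, f i s (y s) ≤ ∑ _i : Fin m, M * C / m :=
      Finset.sum_le_sum (fun i _ => hF3 i s hs _ ⟨hy0 s hs, hyle s hs⟩)
    refine h1.trans ?_
    rw [Finset.sum_const, Finset.card_univ, Fintype.card_fin, nsmul_eq_mul]
    rcases Nat.eq_zero_or_pos m with hm | hm
    · subst hm; simp; positivity
    · have : (m:ℝ) ≠ 0 := by positivity
      rw [mul_div_cancel₀ _ this]
  have hΦ0 : 0 ≤ ∑ j, Φ j (τ j) (y (τ j)) := by
    apply Finset.sum_nonneg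
    intro j _
    have := hΦ j (τ j) (hτ j) (y (τ j)) (hy0 _ (hτ j))
    linarith [this.1, this.2.1]
  have hΦle : ∑ j, Φ j (τ j) (y (τ j)) ≤ C * B := by
    rw [hB, Finset.mul_sum]
    apply Finset.sum_le_sum
    intro j _
    have h0 := hy0 _ (hτ j)
    have h1 := hyle _ (hτ j)
    refine (hΦ j (τ j) (hτ j) (y (τ j)) h0).2.2.trans ?_
    exact mul_le_mul h1 (hβle j _ (hτ j) _ ⟨h0, h1⟩) (hψpos j _ (hτ j) _ h0).le hC.le
  rw [hsup]
  apply Real.sSup_le _ hC.le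
  rintro _ ⟨t, ht, rfl⟩
  simp only [hK]
  have hA0 : 0 ≤ ∫ s in (0:ℝ)..1, G t s * ∑ i, f i s (y s) :=
    intervalIntegral.integral_nonneg zero_le_one
      (fun s hs => mul_nonneg (hG0 t s) (hS0 s hs))
  have hA : (∫ s in (0:ℝ)..1, G t s * ∑ i, f i s (y s)) ≤ I * (M * C) := by
    rw [hIdef, ← intervalIntegral.integral_mul_const,
      intervalIntegral.integral_of_le zero_le_one, intervalIntegral.integral_of_le zero_le_one]
    apply MeasureTheory.integral_mono_of_nonneg
    · filter_upwards [MeasureTheory.ae_restrict_mem measurableSet_Ioc] with s hs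
      exact mul_nonneg (hG0 t s) (hS0 s (Ioc_subset_Icc_self hs))
    · exact (hhi.mul_const (M * C)).1
    · filter_upwards [MeasureTheory.ae_restrict_mem measurableSet_Ioc] with s hs
      have hs' := Ioc_subset_Icc_self hs
      exact mul_le_mul (hGle t ht s hs') (hSle s hs') (hS0 s hs') (hhpos s).le
  have hX : Real.exp (∫ η in (0:ℝ)..t, p η) / (lam - E) ≤ E / (lam - E) := by
    rw [← hP, hE1]
    rw [hE1] at hD
    have := hPmono t ht 1 h11 ht.2
    gcongr
  have hX0 : 0 ≤ Real.exp (∫ η in (0:ℝ)..t, p η) / (lam - E) := by positivity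
  have hZ := mul_le_mul hX hΦle hΦ0 (by positivity)
  rw [abs_of_nonneg (add_nonneg hA0 (mul_nonneg hX0 hΦ0))]
  have hfin : I * (M * C) + E / (lam - E) * (C * B) = C := by
    have : I * (M * C) = C * (M * I) := by ring
    rw [this, hMI]; ring
  linarith
end

section
/- Assume 0 ≤ y·φ_j(t,y) ≤ Φ_j(t,y) ≤ y·ψ_j(t,y) for all t ∈ [0,1], y ∈ [0,∞), j = 1,…,n, and λ > (1 + Σ_{j=1}^n β_j)·E. Let 0 < A ≤ C. If f_i(t,y) < MA/m for all t ∈ [0,1], y ∈ [0,A], and all i = 1,…,m, then for every continuous y : [0,1] → [0,∞) with ‖y‖ ≤ A one has ‖Ky‖ < A. -/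
open Set

/-- Under (F₁), the operator `K` strictly contracts the ball of radius `A`. -/
theorem K_small_ball_strict
    (p : ℝ → ℝ) (hp : ContinuousOn p (Icc (0:ℝ) 1))
    (hp0 : ∀ t ∈ Icc (0:ℝ) 1, 0 ≤ p t)
    (E : ℝ) (hE : E = Real.exp (∫ η in (0:ℝ)..1, p η))
    (lam : ℝ)
    (n m : ℕ) (τ : Fin n → ℝ) (hτ : ∀ j, τ j ∈ Icc (0:ℝ) 1) (hτmono : StrictMono τ)
    (f : Fin m → ℝ → ℝ → ℝ)
    (hfc : ∀ i, ContinuousOn (fun q : ℝ × ℝ => f i q.1 q.2) (Icc (0:ℝ) 1 ×ˢ Ici (0:ℝ)))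
    (hf0 : ∀ i, ∀ t ∈ Icc (0:ℝ) 1, ∀ z ≥ (0:ℝ), 0 ≤ f i t z)
    (Φ φ ψ : Fin n → ℝ → ℝ → ℝ)
    (hφc : ∀ j, ContinuousOn (fun q : ℝ × ℝ => φ j q.1 q.2) (Icc (0:ℝ) 1 ×ˢ Ici (0:ℝ)))
    (hψc : ∀ j, ContinuousOn (fun q : ℝ × ℝ => ψ j q.1 q.2) (Icc (0:ℝ) 1 ×ˢ Ici (0:ℝ)))
    (hφpos : ∀ j, ∀ t ∈ Icc (0:ℝ) 1, ∀ z ≥ (0:ℝ), 0 < φ j t z)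
    (hψpos : ∀ j, ∀ t ∈ Icc (0:ℝ) 1, ∀ z ≥ (0:ℝ), 0 < ψ j t z)
    (hΦ : ∀ j, ∀ t ∈ Icc (0:ℝ) 1, ∀ z ≥ (0:ℝ),
      0 ≤ z * φ j t z ∧ z * φ j t z ≤ Φ j t z ∧ Φ j t z ≤ z * ψ j t z)
    (C : ℝ) (hC : 0 < C)
    (β : Fin n → ℝ)
    (hβ : ∀ j, β j = sSup ((fun q : ℝ × ℝ => ψ j q.1 q.2) ''
      (Icc (0:ℝ) 1 ×ˢ Icc (0:ℝ) C)))
    (hlam : (1 + ∑ j, β j) * E < lam)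
    (G : ℝ → ℝ → ℝ)
    (hG : ∀ t s : ℝ, G t s =
      Real.exp (∫ η in s..t, p η) / (lam - E) * (if s < t then lam else E))
    (M : ℝ)
    (hM : M = (1 / ∫ s in (0:ℝ)..1, G 1 s) * (1 - E * (∑ j, β j) / (lam - E)))
    (K : (ℝ → ℝ) → ℝ → ℝ)
    (hK : ∀ z : ℝ → ℝ, ∀ t : ℝ, K z t =
      (∫ s in (0:ℝ)..1, G t s * ∑ i, f i s (z s)) +
      Real.exp (∫ η in (0:ℝ)..t, p η) / (lam - E) * ∑ j, Φ j (τ j) (z (τ j)))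
    (supnorm : (ℝ → ℝ) → ℝ)
    (hsup : ∀ z : ℝ → ℝ, supnorm z = sSup ((fun t => |z t|) '' Icc (0:ℝ) 1))
    (A : ℝ) (hA : 0 < A) (hAC : A ≤ C)
    (hF1 : ∀ i, ∀ t ∈ Icc (0:ℝ) 1, ∀ z ∈ Icc (0:ℝ) A, f i t z < M * A / m) :
    ∀ y : ℝ → ℝ, ContinuousOn y (Icc (0:ℝ) 1) → (∀ t ∈ Icc (0:ℝ) 1, 0 ≤ y t) →
      supnorm y ≤ A → supnorm (K y) < A := by
  intro y hyc hy0 hyA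
  have hI : ∀ a ∈ Icc (0:ℝ) 1, ∀ b ∈ Icc (0:ℝ) 1,
      IntervalIntegrable p MeasureTheory.volume a b := by
    intro a ha b hb
    apply ContinuousOn.intervalIntegrable
    exact hp.mono ((convex_Icc (0:ℝ) 1).ordConnected.uIcc_subset ha hb)
  have hP0 : ∀ a ∈ Icc (0:ℝ) 1, ∀ b ∈ Icc (0:ℝ) 1, a ≤ b → 0 ≤ ∫ η in a..b, p η := by
    intro a ha b hb hab
    apply intervalIntegral.integral_nonneg hab
    intro u hu
    exact hp0 u ⟨ha.1.trans hu.1, hu.2.trans hb.2⟩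
  have m0 : (0:ℝ) ∈ Icc (0:ℝ) 1 := by simp
  have m1 : (1:ℝ) ∈ Icc (0:ℝ) 1 := by simp
  have hPle : ∀ a ∈ Icc (0:ℝ) 1, ∀ b ∈ Icc (0:ℝ) 1,
      ∫ η in a..b, p η ≤ ∫ η in a..1, p η := by
    intro a ha b hb
    have h1 := intervalIntegral.integral_add_adjacent_intervals (hI a ha b hb) (hI b hb 1 m1)
    have h2 := hP0 b hb 1 m1 hb.2
    linarith
  have hE1 : 1 ≤ E := by
    rw [hE]; exact Real.one_le_exp (hP0 0 m0 1 m1 zero_le_one)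
  have hyb : ∀ t ∈ Icc (0:ℝ) 1, y t ≤ A := by
    intro t ht
    refine (le_abs_self _).trans (le_trans ?_ hyA)
    rw [hsup]
    apply le_csSup (isCompact_Icc.bddAbove_image hyc.abs)
    exact ⟨t, ht, rfl⟩
  have hψβ : ∀ j, ∀ t ∈ Icc (0:ℝ) 1, ∀ z ∈ Icc (0:ℝ) C, ψ j t z ≤ β j := by
    intro j t ht z hz
    rw [hβ]
    apply le_csSup
    · apply (isCompact_Icc.prod isCompact_Icc).bddAbove_image
      apply (hψc j).mono
      exact prod_mono_right Icc_subset_Ici_self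
    · exact ⟨(t, z), ⟨ht, hz⟩, rfl⟩
  have hβ0 : ∀ j, 0 ≤ β j := fun j =>
    (hψpos j 0 m0 0 le_rfl).le.trans (hψβ j 0 m0 0 ⟨le_rfl, hC.le⟩)
  have hS0 : 0 ≤ ∑ j, β j := Finset.sum_nonneg fun j _ => hβ0 j
  set S := ∑ j, β j with hS
  have hSE : 0 ≤ S * E := by positivity
  have hD : 0 < lam - E := by nlinarith
  have hlE : E ≤ lam := by linarith
  have hl0 : 0 < lam := by linarith
  set H : ℝ → ℝ := fun s => Real.exp (∫ η in s..1, p η) / (lam - E) * lam with hH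
  have hHc : ContinuousOn H (Icc (0:ℝ) 1) := by
    have h := intervalIntegral.continuousOn_primitive_interval_left (f := p) (a := 0) (b := 1)
      (μ := MeasureTheory.volume) (by
        rw [uIcc_of_le zero_le_one]; exact hp.integrableOn_Icc)
    rw [uIcc_of_le zero_le_one] at h
    exact ((Real.continuous_exp.comp_continuousOn h).div_const _).mul continuousOn_const
  have hHi : IntervalIntegrable H MeasureTheory.volume 0 1 := by
    apply ContinuousOn.intervalIntegrable
    rwa [uIcc_of_le zero_le_one]
  have hHpos : 0 < ∫ s in (0:ℝ)..1, H s :=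
    intervalIntegral.intervalIntegral_pos_of_pos_on hHi
      (fun x _ => by simp only [hH]; positivity) zero_lt_one
  have hGH : ∫ s in (0:ℝ)..1, G 1 s = ∫ s in (0:ℝ)..1, H s := by
    apply intervalIntegral.integral_congr_ae
    have : ∀ᵐ x : ℝ, x ≠ 1 := by simp [MeasureTheory.ae_iff]
    filter_upwards [this] with x hx hx'
    rw [uIoc_of_le zero_le_one] at hx'
    rw [hG, if_pos (lt_of_le_of_ne hx'.2 hx)]
  have hGle : ∀ t ∈ Icc (0:ℝ) 1, ∀ s ∈ Icc (0:ℝ) 1, 0 ≤ G t s ∧ G t s ≤ H s := by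
    intro t ht s hs
    rw [hG]
    refine ⟨by split_ifs <;> positivity, ?_⟩
    simp only [hH]
    have h1 : Real.exp (∫ η in s..t, p η) ≤ Real.exp (∫ η in s..1, p η) :=
      Real.exp_le_exp.2 (hPle s hs t ht)
    have h2 : (if s < t then lam else E) ≤ lam := by split_ifs <;> linarith
    have h3 : 0 ≤ (if s < t then lam else E) := by split_ifs <;> linarith
    gcongr
  have hgc : ContinuousOn (fun s => ∑ i, f i s (y s)) (Icc (0:ℝ) 1) := by
    apply continuousOn_finsetSum
    intro i _
    exact (hfc i).comp (continuousOn_id.prodMk hyc) (fun s hs => ⟨hs, hy0 s hs⟩)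
  obtain ⟨s0, hs0, hmax⟩ := isCompact_Icc.exists_isMaxOn ⟨0, m0⟩ hgc
  have hg0 : ∀ s ∈ Icc (0:ℝ) 1, 0 ≤ ∑ i, f i s (y s) := fun s hs =>
    Finset.sum_nonneg fun i _ => hf0 i s hs _ (hy0 s hs)
  have hM' : M = (1 / ∫ s in (0:ℝ)..1, H s) * (1 - E * S / (lam - E)) := by rw [hM, hGH]
  have hfrac : E * S / (lam - E) < 1 := by rw [div_lt_one hD]; nlinarith
  have hMpos : 0 < M := by
    rw [hM']; exact mul_pos (by positivity) (by linarith)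
  set c := ∑ i, f i s0 (y s0) with hc
  have hcM : c < M * A := by
    rcases Nat.eq_zero_or_pos m with h | h
    · subst h; simp [hc]; positivity
    · have : Nonempty (Fin m) := ⟨⟨0, h⟩⟩
      have : c < ∑ _i : Fin m, M * A / m :=
        Finset.sum_lt_sum_of_nonempty Finset.univ_nonempty
          fun i _ => hF1 i s0 hs0 _ ⟨hy0 s0 hs0, hyb s0 hs0⟩
      have hm : (m:ℝ) ≠ 0 := by positivity
      simp at this
      rwa [mul_div_cancel₀ _ hm] at this
  have hΦ0 : 0 ≤ ∑ j, Φ j (τ j) (y (τ j)) := Finset.sum_nonneg fun j _ => by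
    have := hΦ j (τ j) (hτ j) _ (hy0 _ (hτ j))
    linarith [this.1, this.2.1]
  have hΦA : ∑ j, Φ j (τ j) (y (τ j)) ≤ S * A := by
    rw [hS, Finset.sum_mul]
    apply Finset.sum_le_sum
    intro j _
    have h0 := hy0 _ (hτ j)
    have hA' := hyb _ (hτ j)
    have := (hΦ j (τ j) (hτ j) _ h0).2.2
    have h2 := hψβ j (τ j) (hτ j) _ ⟨h0, hA'.trans hAC⟩
    calc _ ≤ _ := this
      _ ≤ A * β j := mul_le_mul hA' h2 (hψpos j _ (hτ j) _ h0).le hA.le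
      _ = _ := mul_comm _ _
  have hB : (∫ s in (0:ℝ)..1, H s) * c + E / (lam - E) * (S * A) < A := by
    have h1 := mul_lt_mul_of_pos_left hcM hHpos
    have h2 : (∫ s in (0:ℝ)..1, H s) * M = 1 - E * S / (lam - E) := by
      rw [hM']; field_simp
    have h3 : E / (lam - E) * (S * A) = E * S / (lam - E) * A := by ring
    rw [h3]
    rw [← mul_assoc, h2] at h1
    linarith
  refine lt_of_le_of_lt ?_ hB
  rw [hsup]
  apply csSup_le (Set.Nonempty.image _ ⟨0, m0⟩)
  rintro _ ⟨t, ht, rfl⟩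
  have hint0 : 0 ≤ ∫ s in (0:ℝ)..1, G t s * ∑ i, f i s (y s) :=
    intervalIntegral.integral_nonneg zero_le_one
      fun s hs => mul_nonneg (hGle t ht s hs).1 (hg0 s hs)
  have hint : ∫ s in (0:ℝ)..1, G t s * ∑ i, f i s (y s) ≤ (∫ s in (0:ℝ)..1, H s) * c := by
    rw [← intervalIntegral.integral_mul_const]
    rw [intervalIntegral.integral_of_le zero_le_one, intervalIntegral.integral_of_le zero_le_one]
    apply MeasureTheory.integral_mono_of_nonneg
    · filter_upwards [MeasureTheory.ae_restrict_mem measurableSet_Ioc] with s hs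
      have hs := Ioc_subset_Icc_self hs
      exact mul_nonneg (hGle t ht s hs).1 (hg0 s hs)
    · exact (hHi.mul_const c).1
    · filter_upwards [MeasureTheory.ae_restrict_mem measurableSet_Ioc] with s hs
      have hs := Ioc_subset_Icc_self hs
      have h := hGle t ht s hs
      exact mul_le_mul h.2 (hmax hs) (hg0 s hs) (h.1.trans h.2)
  have hexp : Real.exp (∫ η in (0:ℝ)..t, p η) ≤ E := by
    rw [hE]; exact Real.exp_le_exp.2 (hPle 0 m0 t ht)
  have hlast : Real.exp (∫ η in (0:ℝ)..t, p η) / (lam - E) * ∑ j, Φ j (τ j) (y (τ j))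
      ≤ E / (lam - E) * (S * A) := by
    apply mul_le_mul _ hΦA hΦ0 (by positivity)
    exact div_le_div_of_nonneg_right hexp hD.le
  have hlast0 : 0 ≤ Real.exp (∫ η in (0:ℝ)..t, p η) / (lam - E) * ∑ j, Φ j (τ j) (y (τ j)) :=
    mul_nonneg (by positivity) hΦ0
  simp only [hK]
  rw [abs_of_nonneg (add_nonneg hint0 hlast0)]
  exact add_le_add hint hlast
end

section
/- Assume 0 ≤ y·φ_j(t,y) ≤ Φ_j(t,y) ≤ y·ψ_j(t,y) for all t ∈ [0,1], y ∈ [0,∞), j = 1,…,n, with φ_j, ψ_j positive and continuous, and λ > (1 + Σ_{j=1}^n β_j)·E. Then every nonnegative continuously differentiable solution y of y′(t) − p(t)y(t) = Σ_{i=1}^m f_i(t,y(t)) on [0,1] with λ y(0) = y(1) + Σ_{j=1}^n Φ_j(τ_j, y(τ_j)) is nondecreasing on [0,1] and satisfies ‖y‖ = y(1) and min_{t∈[0,1]} y(t) = y(0) ≥ ‖y‖/λ. -/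
open Set

/-- Every nonnegative solution of the boundary value problem is nondecreasing on
`[0,1]`, with `‖y‖ = y(1)` and minimum `y(0) ≥ ‖y‖/λ`. -/
theorem solutions_are_monotone
    (p : ℝ → ℝ) (hp : ContinuousOn p (Icc (0:ℝ) 1))
    (hp0 : ∀ t ∈ Icc (0:ℝ) 1, 0 ≤ p t)
    (E : ℝ) (hE : E = Real.exp (∫ η in (0:ℝ)..1, p η))
    (lam : ℝ)
    (n m : ℕ) (τ : Fin n → ℝ) (hτ : ∀ j, τ j ∈ Icc (0:ℝ) 1) (hτmono : StrictMono τ)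
    (f : Fin m → ℝ → ℝ → ℝ)
    (hfc : ∀ i, ContinuousOn (fun q : ℝ × ℝ => f i q.1 q.2) (Icc (0:ℝ) 1 ×ˢ Ici (0:ℝ)))
    (hf0 : ∀ i, ∀ t ∈ Icc (0:ℝ) 1, ∀ z ≥ (0:ℝ), 0 ≤ f i t z)
    (Φ φ ψ : Fin n → ℝ → ℝ → ℝ)
    (hΦc : ∀ j, ContinuousOn (fun q : ℝ × ℝ => Φ j q.1 q.2) (Icc (0:ℝ) 1 ×ˢ Ici (0:ℝ)))
    (hφc : ∀ j, ContinuousOn (fun q : ℝ × ℝ => φ j q.1 q.2) (Icc (0:ℝ) 1 ×ˢ Ici (0:ℝ)))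
    (hψc : ∀ j, ContinuousOn (fun q : ℝ × ℝ => ψ j q.1 q.2) (Icc (0:ℝ) 1 ×ˢ Ici (0:ℝ)))
    (hφpos : ∀ j, ∀ t ∈ Icc (0:ℝ) 1, ∀ z ≥ (0:ℝ), 0 < φ j t z)
    (hψpos : ∀ j, ∀ t ∈ Icc (0:ℝ) 1, ∀ z ≥ (0:ℝ), 0 < ψ j t z)
    (hΦ : ∀ j, ∀ t ∈ Icc (0:ℝ) 1, ∀ z ≥ (0:ℝ),
      0 ≤ z * φ j t z ∧ z * φ j t z ≤ Φ j t z ∧ Φ j t z ≤ z * ψ j t z)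
    (C : ℝ) (hC : 0 < C)
    (β : Fin n → ℝ)
    (hβ : ∀ j, β j = sSup ((fun q : ℝ × ℝ => ψ j q.1 q.2) ''
      (Icc (0:ℝ) 1 ×ˢ Icc (0:ℝ) C)))
    (hlam : (1 + ∑ j, β j) * E < lam)
    (supnorm : (ℝ → ℝ) → ℝ)
    (hsup : ∀ z : ℝ → ℝ, supnorm z = sSup ((fun t => |z t|) '' Icc (0:ℝ) 1)) :
    ∀ y : ℝ → ℝ,
      (∀ t ∈ Icc (0:ℝ) 1, 0 ≤ y t) →
      (∀ t ∈ Icc (0:ℝ) 1,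
        HasDerivWithinAt y (p t * y t + ∑ i, f i t (y t)) (Icc (0:ℝ) 1) t) →
      lam * y 0 = y 1 + ∑ j, Φ j (τ j) (y (τ j)) →
      MonotoneOn y (Icc (0:ℝ) 1) ∧
      supnorm y = y 1 ∧
      (∀ t ∈ Icc (0:ℝ) 1, y 0 ≤ y t) ∧
      supnorm y / lam ≤ y 0 := by
  intro y hy hd hbc
  have hmono : MonotoneOn y (Icc (0:ℝ) 1) := by
    refine monotoneOn_of_hasDerivWithinAt_nonneg (convex_Icc 0 1)
      (fun t ht => (hd t ht).continuousWithinAt)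
      (fun t ht => (hd t (interior_subset ht)).mono interior_subset) ?_
    intro t ht
    have ht' := interior_subset ht
    exact add_nonneg (mul_nonneg (hp0 t ht') (hy t ht'))
      (Finset.sum_nonneg fun i _ => hf0 i t ht' _ (hy t ht'))
  have h0 : (0:ℝ) ∈ Icc (0:ℝ) 1 := by simp
  have h1 : (1:ℝ) ∈ Icc (0:ℝ) 1 := by simp
  have hs : supnorm y = y 1 := by
    rw [hsup]
    apply IsGreatest.csSup_eq
    refine ⟨⟨1, h1, abs_of_nonneg (hy 1 h1)⟩, ?_⟩
    rintro _ ⟨t, ht, rfl⟩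
    simp only [abs_of_nonneg (hy t ht)]
    exact hmono ht h1 ht.2
  have hβ0 : ∀ j, 0 ≤ β j := by
    intro j
    rw [hβ]
    apply Real.sSup_nonneg
    rintro _ ⟨q, hq, rfl⟩
    exact (hψpos j q.1 hq.1 q.2 hq.2.1).le
  have hE0 : 0 < E := hE ▸ Real.exp_pos _
  have hl : 0 < lam := by
    have := Finset.sum_nonneg fun j (_ : j ∈ Finset.univ) => hβ0 j
    exact lt_of_le_of_lt (by positivity) hlam
  have hS : 0 ≤ ∑ j, Φ j (τ j) (y (τ j)) := Finset.sum_nonneg fun j _ =>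
    (hΦ j _ (hτ j) _ (hy _ (hτ j))).1.trans (hΦ j _ (hτ j) _ (hy _ (hτ j))).2.1
  refine ⟨hmono, hs, fun t ht => hmono h0 ht ht.1, ?_⟩
  rw [hs, div_le_iff₀ hl]
  linarith
end
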